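/- arXiv:1812.05142 — 4 statements merged into one kernel-verified Lean document; each statement's English description precedes it below -/
import Mathlib

section
/- Let ρ and σ be d×d density matrices with σ positive definite, let ε ∈ (0,1), and let M be a complex Hermitian matrix with 0 ≤ M ≤ I (Loewner order) such that Tr[(I − M)ρ] ≤ ε. Then −ln Tr[Mσ] ≤ (D(ρ‖σ) + ln 2)/(1 − ε). (This is the converse bound behind the composite quantum Stein's lemma: applied to ρ^{⊗n} in place of ρ and to any mixture σ_n(μ) of n-fold tensor powers in place of σ, it bounds the type II error exponent of any test with type I error at most ε.) -/
open Matrix ComplexOrder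

/-- Matrix logarithm of a Hermitian matrix, via the spectral decomposition
(junk value `0` on non-Hermitian matrices). -/
noncomputable def matLog {d : ℕ} (σ : Matrix (Fin d) (Fin d) ℂ) : Matrix (Fin d) (Fin d) ℂ :=
  if h : σ.IsHermitian then
    (h.eigenvectorUnitary : Matrix (Fin d) (Fin d) ℂ) *
      Matrix.diagonal (fun i => (Real.log (h.eigenvalues i) : ℂ)) *
      star (h.eigenvectorUnitary : Matrix (Fin d) (Fin d) ℂ)
  else 0

/-- `Tr[ρ ln ρ] = Σ_i λ_i ln λ_i` over the eigenvalues of a Hermitian matrix `ρ`,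
with the convention `0 ln 0 = 0` (junk value `0` on non-Hermitian matrices). -/
noncomputable def trMulLogSelf {d : ℕ} (ρ : Matrix (Fin d) (Fin d) ℂ) : ℝ :=
  if h : ρ.IsHermitian then ∑ i, h.eigenvalues i * Real.log (h.eigenvalues i) else 0

/-- Quantum relative entropy `D(ρ‖σ) := Tr[ρ ln ρ] − Tr[ρ ln σ]` (natural logarithm). -/
noncomputable def relEnt {d : ℕ} (ρ σ : Matrix (Fin d) (Fin d) ℂ) : ℝ :=
  trMulLogSelf ρ - ((ρ * matLog σ).trace).re

lemma tr_diag {d : ℕ} (a b : Fin d → ℝ) (X : Matrix (Fin d) (Fin d) ℂ) :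
    (Matrix.diagonal (fun i => (a i : ℂ)) * star X * Matrix.diagonal (fun i => (b i : ℂ)) * X).trace.re
      = ∑ j, ∑ k, a j * b k * Complex.normSq (X k j) := by
  simp only [Matrix.trace, Matrix.diag_apply, Complex.re_sum]
  refine Finset.sum_congr rfl fun j _ => ?_
  rw [Matrix.mul_apply, Complex.re_sum]
  refine Finset.sum_congr rfl fun k _ => ?_
  rw [Matrix.mul_diagonal, Matrix.diagonal_mul, Matrix.star_apply]
  simp [Complex.normSq_apply]
  ring

lemma tr_diag2 {d : ℕ} (a : Fin d → ℝ) (X Z : Matrix (Fin d) (Fin d) ℂ) :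
    (Matrix.diagonal (fun i => (a i : ℂ)) * star X * Z).trace.re
      = ∑ j, ∑ k, a j * ((X k j).re * (Z k j).re + (X k j).im * (Z k j).im) := by
  simp only [Matrix.trace, Matrix.diag_apply, Complex.re_sum]
  refine Finset.sum_congr rfl fun j _ => ?_
  rw [Matrix.mul_apply, Complex.re_sum]
  refine Finset.sum_congr rfl fun k _ => ?_
  rw [Matrix.diagonal_mul, Matrix.star_apply]
  simp
  ring

lemma psd_tr_nonneg {d : ℕ} {A B : Matrix (Fin d) (Fin d) ℂ} (hA : A.PosSemidef)
    (hB : B.PosSemidef) : 0 ≤ (A * B).trace.re := by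
  obtain ⟨C, rfl⟩ : ∃ C : Matrix (Fin d) (Fin d) ℂ, B = C * star C := by
    have hs := hB.isHermitian.spectral_theorem
    let V := (hB.isHermitian.eigenvectorUnitary : Matrix (Fin d) (Fin d) ℂ)
    let D : Matrix (Fin d) (Fin d) ℂ :=
      Matrix.diagonal (fun i => ((Real.sqrt (hB.isHermitian.eigenvalues i) : ℝ) : ℂ))
    refine ⟨V * D, ?_⟩
    have hD : D * star D = Matrix.diagonal (fun i => ((hB.isHermitian.eigenvalues i : ℝ) : ℂ)) := by
      simp only [D, Matrix.star_eq_conjTranspose, Matrix.diagonal_conjTranspose,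
        Matrix.diagonal_mul_diagonal]
      congr 1; ext i
      simp only [Pi.star_apply, Complex.star_def, Complex.conj_ofReal]
      rw [← Complex.ofReal_mul, Real.mul_self_sqrt (hB.eigenvalues_nonneg i)]
    rw [star_mul, mul_assoc, ← mul_assoc D, hD, ← mul_assoc]
    rw [Unitary.conjStarAlgAut_apply] at hs
    exact hs
  rw [← mul_assoc, Matrix.trace_mul_comm, ← mul_assoc, Matrix.star_eq_conjTranspose]
  have := (hA.conjTranspose_mul_mul_same C).trace_nonneg
  exact (Complex.le_def.1 this).1

lemma spec {d : ℕ} {A : Matrix (Fin d) (Fin d) ℂ} (h : A.IsHermitian) :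
    A = (h.eigenvectorUnitary : Matrix (Fin d) (Fin d) ℂ) *
      Matrix.diagonal (fun i => ((h.eigenvalues i : ℝ) : ℂ)) *
      star (h.eigenvectorUnitary : Matrix (Fin d) (Fin d) ℂ) := by
  have hs := h.spectral_theorem
  rw [Unitary.conjStarAlgAut_apply] at hs
  exact hs

/-- the variational bound, in eigenbases -/
lemma var_bound {d : ℕ} (U V Y ρ σ : Matrix (Fin d) (Fin d) ℂ) (l m : Fin d → ℝ)
    (hU : U * star U = 1) (hV : V * star V = 1)
    (hY : star Y = Y)
    (hl : ∀ j, 0 ≤ l j) (hm : ∀ j, 0 < m j)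
    (hρ : ρ = V * Matrix.diagonal (fun i => (l i : ℂ)) * star V)
    (hσ : σ = U * Matrix.diagonal (fun i => (m i : ℂ)) * star U) (s : ℝ) (hs : 0 ≤ s) :
    2 * (ρ * Y).trace.re - (σ * (Y * Y)).trace.re - s * (ρ * (Y * Y)).trace.re ≤
      ∑ j, ∑ k, Complex.normSq ((star U * V) k j) * (l j ^ 2 / (m k + s * l j)) := by
  set W := star U * V with hW
  set Z := star U * Y * V with hZ
  set D := Matrix.diagonal (fun i => (l i : ℂ)) with hD
  set E := Matrix.diagonal (fun i => (m i : ℂ)) with hE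
  have one : (1 : Matrix (Fin d) (Fin d) ℂ) = Matrix.diagonal (fun i => ((1:ℝ) : ℂ)) := by
    simp
  have cU : ∀ X : Matrix (Fin d) (Fin d) ℂ, U * (star U * X) = X := fun X => by
    rw [← mul_assoc, hU, one_mul]
  have cV : ∀ X : Matrix (Fin d) (Fin d) ℂ, V * (star V * X) = X := fun X => by
    rw [← mul_assoc, hV, one_mul]
  have h1 : (ρ * Y).trace.re = ∑ j, ∑ k, l j * ((W k j).re * (Z k j).re + (W k j).im * (Z k j).im) := by
    rw [← tr_diag2, ← hD, hρ, mul_assoc, mul_assoc, Matrix.trace_mul_comm]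
    simp only [hW, hZ, star_mul, star_star, mul_assoc, cU]
  have h2 : (ρ * (Y * Y)).trace.re = ∑ j, ∑ k, l j * 1 * Complex.normSq (Z k j) := by
    rw [← tr_diag l (fun _ => 1), ← hD, ← one, hρ, mul_assoc, mul_assoc, Matrix.trace_mul_comm]
    simp only [hZ, star_mul, star_star, mul_assoc, cU, hY, one_mul]
  have h3 : (σ * (Y * Y)).trace.re = ∑ j, ∑ k, 1 * m k * Complex.normSq (Z k j) := by
    rw [← tr_diag (fun _ => 1) m, ← hE, ← one, hσ, one_mul, mul_assoc (star Z),
      Matrix.trace_mul_comm (star Z), mul_assoc, mul_assoc, Matrix.trace_mul_comm U]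
    simp only [hZ, star_mul, star_star, mul_assoc, cV, hY]
  rw [h1, h2, h3]
  simp only [Finset.mul_sum, ← Finset.sum_sub_distrib]
  refine Finset.sum_le_sum fun j _ => Finset.sum_le_sum fun k _ => ?_
  have hp : 0 < m k + s * l j := by have := hm k; have := mul_nonneg hs (hl j); linarith
  rw [← mul_div_assoc, le_div_iff₀ hp, Complex.normSq_apply, Complex.normSq_apply]
  nlinarith [sq_nonneg (l j * (W k j).re - (m k + s * l j) * (Z k j).re),
    sq_nonneg (l j * (W k j).im - (m k + s * l j) * (Z k j).im)]

lemma term_deriv (l m S : ℝ) (h : 0 < m + S * l) :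
    HasDerivAt (fun S => l * (Real.log (m + S * l) - Real.log m)) (l ^ 2 / (m + S * l)) S := by
  have h1 : HasDerivAt (fun S : ℝ => m + S * l) (1 * l) S :=
    ((hasDerivAt_id S).mul_const l).const_add m
  have := ((h1.log h.ne').sub_const (Real.log m)).const_mul l
  have e : l ^ 2 / (m + S * l) = l * (1 * l / (m + S * l)) := by
    rw [one_mul, pow_two, mul_div_assoc]
  rw [e]
  exact this

lemma term_lim (l m : ℝ) (hl : 0 ≤ l) (hm : 0 < m) :
    Filter.Tendsto (fun S => l * (Real.log (m + S * l) - Real.log m) - l * Real.log S)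
      Filter.atTop (nhds (l * (Real.log l - Real.log m))) := by
  rcases hl.eq_or_lt with rfl | hl
  · simp
  have h1 : Filter.Tendsto (fun S : ℝ => m * S⁻¹ + l) Filter.atTop (nhds (m * 0 + l)) :=
    (tendsto_inv_atTop_zero.const_mul m).add_const l
  rw [mul_zero, zero_add] at h1
  have h2 := (((Real.continuousAt_log hl.ne').tendsto.comp h1).sub_const (Real.log m)).const_mul l
  refine h2.congr' ?_
  filter_upwards [Filter.eventually_gt_atTop 0] with S hS
  have : m + S * l = S * (m * S⁻¹ + l) := by field_simp
  rw [this, Real.log_mul hS.ne' (by positivity)]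
  simp only [Function.comp]
  ring

/-- scalar comparison: an inequality between resolvents gives one between logarithms -/
lemma log_compare {ι κ : Type*} [Fintype ι] [Fintype κ] (P : ι → ℝ) (l m : ι → ℝ)
    (p q : κ → ℝ) (hl : ∀ i, 0 ≤ l i) (hm : ∀ i, 0 < m i) (hp : ∀ i, 0 ≤ p i)
    (hq : ∀ i, 0 < q i) (hsum : ∑ i, P i * l i = ∑ i, p i)
    (h : ∀ s : ℝ, 0 ≤ s → ∑ i, p i ^ 2 / (q i + s * p i) ≤ ∑ i, P i * (l i ^ 2 / (m i + s * l i))) :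
    ∑ i, p i * (Real.log (p i) - Real.log (q i)) ≤
      ∑ i, P i * (l i * (Real.log (l i) - Real.log (m i))) := by
  let G : ℝ → ℝ := fun S => ∑ i, P i * (l i * (Real.log (m i + S * l i) - Real.log (m i)))
    - ∑ i, p i * (Real.log (q i + S * p i) - Real.log (q i))
  have hd : ∀ S, 0 ≤ S → HasDerivAt G (∑ i, P i * (l i ^ 2 / (m i + S * l i))
      - ∑ i, p i ^ 2 / (q i + S * p i)) S := by
    intro S hS
    refine HasDerivAt.sub ?_ ?_
    · refine HasDerivAt.fun_sum fun i _ => (term_deriv _ _ _ ?_).const_mul _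
      have := hm i; have := mul_nonneg hS (hl i); linarith
    · refine HasDerivAt.fun_sum fun i _ => term_deriv _ _ _ ?_
      have := hq i; have := mul_nonneg hS (hp i); linarith
  have hmono : MonotoneOn G (Set.Ici 0) := by
    refine monotoneOn_of_deriv_nonneg (convex_Ici 0)
      (fun S hS => (hd S hS).continuousAt.continuousWithinAt) ?_ ?_
    · intro S hS
      rw [interior_Ici] at hS
      exact (hd S (le_of_lt hS)).differentiableAt.differentiableWithinAt
    · intro S hS
      rw [interior_Ici] at hS
      rw [(hd S (le_of_lt hS)).deriv]
      have := h S (le_of_lt hS)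
      linarith
  have hlim : Filter.Tendsto G Filter.atTop (nhds
      (∑ i, P i * (l i * (Real.log (l i) - Real.log (m i)))
        - ∑ i, p i * (Real.log (p i) - Real.log (q i)))) := by
    have a1 := tendsto_finsetSum Finset.univ
      fun i (_ : i ∈ Finset.univ) => (term_lim (l i) (m i) (hl i) (hm i)).const_mul (P i)
    have a2 := tendsto_finsetSum Finset.univ
      fun i (_ : i ∈ Finset.univ) => term_lim (p i) (q i) (hp i) (hq i)
    refine (a1.sub a2).congr fun S => ?_
    simp only [mul_sub (P _), Finset.sum_sub_distrib, G]
    simp only [← mul_assoc, ← Finset.sum_mul, hsum]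
    ring
  have h0 : G 0 = 0 := by simp [G]
  have : 0 ≤ ∑ i, P i * (l i * (Real.log (l i) - Real.log (m i)))
        - ∑ i, p i * (Real.log (p i) - Real.log (q i)) := by
    refine ge_of_tendsto hlim ?_
    filter_upwards [Filter.eventually_ge_atTop 0] with S hS
    rw [← h0]
    exact hmono Set.self_mem_Ici hS hS
  linarith

/-- **Converse bound behind the composite quantum Stein's lemma.** If `ρ, σ` are density
matrices with `σ` positive definite, `ε ∈ (0,1)`, and `0 ≤ M ≤ I` is a test with type I
error `Tr[(I−M)ρ] ≤ ε`, then `−ln Tr[Mσ] ≤ (D(ρ‖σ) + ln 2)/(1 − ε)`. -/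
theorem stein_converse {d : ℕ} (ρ σ M : Matrix (Fin d) (Fin d) ℂ) (ε : ℝ)
    (hρ : ρ.PosSemidef) (hρtr : ρ.trace = 1)
    (hσ : σ.PosDef) (hσtr : σ.trace = 1)
    (hε : ε ∈ Set.Ioo (0 : ℝ) 1)
    (hM0 : M.PosSemidef) (hM1 : ((1 : Matrix (Fin d) (Fin d) ℂ) - M).PosSemidef)
    (htest : (((1 : Matrix (Fin d) (Fin d) ℂ) - M) * ρ).trace.re ≤ ε) :
    -Real.log ((M * σ).trace.re) ≤ (relEnt ρ σ + Real.log 2) / (1 - ε) := by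
  obtain ⟨hε0, hε1⟩ := hε
  have hρH := hρ.isHermitian
  have hσH := hσ.isHermitian
  set V := (hρH.eigenvectorUnitary : Matrix (Fin d) (Fin d) ℂ) with hVdef
  set U := (hσH.eigenvectorUnitary : Matrix (Fin d) (Fin d) ℂ) with hUdef
  set l := hρH.eigenvalues with hldef
  set m := hσH.eigenvalues with hmdef
  have hl : ∀ j, 0 ≤ l j := hρ.eigenvalues_nonneg
  have hm : ∀ j, 0 < m j := hσ.eigenvalues_pos
  have hU : U * star U = 1 := Unitary.coe_mul_star_self _
  have hV : V * star V = 1 := Unitary.coe_mul_star_self _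
  have hU' : star U * U = 1 := Unitary.coe_star_mul_self _
  have hV' : star V * V = 1 := Unitary.coe_star_mul_self _
  have eρ : ρ = V * Matrix.diagonal (fun i => (l i : ℂ)) * star V := spec hρH
  have eσ : σ = U * Matrix.diagonal (fun i => (m i : ℂ)) * star U := spec hσH
  set W := star U * V with hW
  have hWW : star W * W = 1 := by
    rw [hW, star_mul, star_star, mul_assoc, ← mul_assoc U, hU, one_mul, hV']
  have hcol : ∀ j, ∑ k, Complex.normSq (W k j) = 1 := by
    intro j
    have := congrArg (fun X : Matrix (Fin d) (Fin d) ℂ => (X j j).re) hWW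
    simp only [Matrix.mul_apply, Matrix.star_apply, Complex.re_sum, Matrix.one_apply_eq,
      Complex.one_re] at this
    rw [← this]
    refine Finset.sum_congr rfl fun k _ => ?_
    simp [Complex.normSq_apply]
  -- relative entropy in eigenbases
  have hD : relEnt ρ σ = ∑ i : Fin d × Fin d, Complex.normSq (W i.2 i.1) *
      (l i.1 * (Real.log (l i.1) - Real.log (m i.2))) := by
    rw [Fintype.sum_prod_type]
    have h2 : (ρ * matLog σ).trace.re =
        ∑ j, ∑ k, l j * Real.log (m k) * Complex.normSq (W k j) := by
      rw [← tr_diag, matLog, dif_pos hσH, ← hUdef, ← hmdef, eρ, mul_assoc, mul_assoc,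
        Matrix.trace_mul_comm]
      simp only [hW, star_mul, star_star, mul_assoc]
    rw [relEnt, trMulLogSelf, dif_pos hρH, ← hldef, h2, ← Finset.sum_sub_distrib]
    refine Finset.sum_congr rfl fun j _ => ?_
    simp only [mul_sub, Finset.sum_sub_distrib, ← Finset.sum_mul, hcol, one_mul]
    congr 1
    exact Finset.sum_congr rfl fun k _ => by ring
  have hltr : ∑ j, l j = 1 := by
    have := hρH.trace_eq_sum_eigenvalues
    rw [hρtr] at this
    have h := congrArg Complex.re this
    simpa using h.symm
  -- probabilities
  set p := (M * ρ).trace.re with hp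
  set q := (M * σ).trace.re with hq
  have hp1 : ((1 - M) * ρ).trace.re = 1 - p := by
    rw [sub_mul, one_mul, Matrix.trace_sub, hρtr]; simp [hp]
  have hq1 : ((1 - M) * σ).trace.re = 1 - q := by
    rw [sub_mul, one_mul, Matrix.trace_sub, hσtr]; simp [hq]
  have hp1' : 0 ≤ 1 - p := hp1 ▸ psd_tr_nonneg hM1 hρ
  have hq1' : 0 ≤ 1 - q := hq1 ▸ psd_tr_nonneg hM1 hσ.posSemidef
  have hpε : 1 - ε ≤ p := by rw [hp1] at htest; linarith
  have hp0 : 0 < p := by linarith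
  -- operator inequality
  have hMH : star M = M := hM0.isHermitian
  have hNH : star (1 - M) = 1 - M := hM1.isHermitian
  have hMM : (M - M * M).PosSemidef := by
    have a := hM0.conjTranspose_mul_mul_same (1 - M)
    have b := hM1.conjTranspose_mul_mul_same M
    have c := a.add b
    rw [← Matrix.star_eq_conjTranspose, ← Matrix.star_eq_conjTranspose, hMH, hNH] at c
    convert c using 1
    noncomm_ring
  have hvar : ∀ (s : ℝ), 0 ≤ s → ∀ y z : ℝ,
      2 * (y * p + z * (1 - p)) - (y ^ 2 * (q + s * p) + z ^ 2 * ((1 - q) + s * (1 - p)))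
      ≤ ∑ j, ∑ k, Complex.normSq (W k j) * (l j ^ 2 / (m k + s * l j)) := by
    intro s hs y z
    set Y : Matrix (Fin d) (Fin d) ℂ := (y : ℂ) • M + (z : ℂ) • (1 - M) with hY
    have hYH : star Y = Y := by
      rw [hY, star_add, star_smul, star_smul, hMH, hNH]; simp
    have key := var_bound U V Y ρ σ l m hU hV hYH hl hm eρ eσ s hs
    have hYY : Y * Y = ((y ^ 2 : ℝ) : ℂ) • M + ((z ^ 2 : ℝ) : ℂ) • (1 - M)
        - (((y - z) ^ 2 : ℝ) : ℂ) • (M - M * M) := by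
      rw [hY]
      simp only [add_mul, mul_add, smul_mul_smul_comm, mul_sub, sub_mul, one_mul, mul_one]
      push_cast
      module
    have e1 : (ρ * Y).trace.re = y * p + z * (1 - p) := by
      rw [Matrix.trace_mul_comm, hY, add_mul, Matrix.trace_add, smul_mul_assoc, smul_mul_assoc,
        Matrix.trace_smul, Matrix.trace_smul, ← hp1, hp]
      simp
    have e2 : (ρ * (Y * Y)).trace.re = y ^ 2 * p + z ^ 2 * (1 - p)
        - (y - z) ^ 2 * ((M - M * M) * ρ).trace.re := by
      rw [Matrix.trace_mul_comm, hYY, sub_mul, add_mul, Matrix.trace_sub, Matrix.trace_add,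
        smul_mul_assoc, smul_mul_assoc, smul_mul_assoc,
        Matrix.trace_smul, Matrix.trace_smul, Matrix.trace_smul, ← hp1, hp, Complex.sub_re,
        Complex.add_re]
      simp only [smul_eq_mul, Complex.re_ofReal_mul]
    have e3 : (σ * (Y * Y)).trace.re = y ^ 2 * q + z ^ 2 * (1 - q)
        - (y - z) ^ 2 * ((M - M * M) * σ).trace.re := by
      rw [Matrix.trace_mul_comm, hYY, sub_mul, add_mul, Matrix.trace_sub, Matrix.trace_add,
        smul_mul_assoc, smul_mul_assoc, smul_mul_assoc,
        Matrix.trace_smul, Matrix.trace_smul, Matrix.trace_smul, ← hq1, hq, Complex.sub_re,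
        Complex.add_re]
      simp only [smul_eq_mul, Complex.re_ofReal_mul]
    rw [e1, e2, e3] at key
    have f1 := mul_nonneg hs (mul_nonneg (sq_nonneg (y - z)) (psd_tr_nonneg hMM hρ))
    have f2 := mul_nonneg (sq_nonneg (y - z)) (psd_tr_nonneg hMM hσ.posSemidef)
    refine le_trans ?_ key
    linarith
  have hq0 : 0 < q := by
    have h0 : 0 ≤ q := psd_tr_nonneg hM0 hσ.posSemidef
    refine lt_of_le_of_ne h0 fun hq0 => ?_
    -- with `q = 0` the bound at `s = 0` is unbounded in `y`
    set C := ∑ j, ∑ k, Complex.normSq (W k j) * (l j ^ 2 / (m k + 0 * l j)) with hC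
    have := hvar 0 le_rfl ((C + 1) / (2 * p)) 0
    rw [← hq0, ← hC] at this
    have e : 2 * ((C + 1) / (2 * p) * p) = C + 1 := by field_simp
    linarith
  have main := log_compare (fun i : Fin d × Fin d => Complex.normSq (W i.2 i.1))
    (fun i => l i.1) (fun i => m i.2) (![p, 1 - p]) (![q, 1]) (fun i => hl _) (fun i => hm _)
    (by intro i; fin_cases i <;> simp <;> linarith) (by intro i; fin_cases i <;> simp [hq0])
    (by
      rw [Fintype.sum_prod_type]
      simp only [← Finset.sum_mul, hcol, one_mul, hltr]
      simp)
    (by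
      intro s hs
      rw [Fintype.sum_prod_type]
      have a0 : 0 < q + s * p := by positivity
      have b0 : 0 < 1 + s * (1 - p) := by positivity
      refine le_trans ?_ (hvar s hs (p / (q + s * p)) ((1 - p) / (1 + s * (1 - p))))
      simp only [Fin.sum_univ_two, Matrix.cons_val_zero, Matrix.cons_val_one]
      have a1 : (p / (q + s * p)) ^ 2 * (q + s * p) = p ^ 2 / (q + s * p) := by field_simp
      have a2 : (p / (q + s * p)) * p = p ^ 2 / (q + s * p) := by ring
      have b1 : ((1 - p) / (1 + s * (1 - p))) ^ 2 * (1 + s * (1 - p))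
        = (1 - p) ^ 2 / (1 + s * (1 - p)) := by field_simp
      have b2 : ((1 - p) / (1 + s * (1 - p))) * (1 - p)
        = (1 - p) ^ 2 / (1 + s * (1 - p)) := by ring
      have c := mul_nonneg (sq_nonneg ((1 - p) / (1 + s * (1 - p)))) hq0.le
      rw [a1, a2, b2]
      linarith)
  rw [← hD] at main
  simp only [Fin.sum_univ_two, Matrix.cons_val_zero, Matrix.cons_val_one, Real.log_one] at main
  have hent := Real.binEntropy_le_log_two (p := p)
  rw [Real.binEntropy_eq_negMulLog_add_negMulLog_one_sub, Real.negMulLog, Real.negMulLog] at hent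
  have hlogq : 0 ≤ -Real.log q := by
    have := Real.log_nonpos hq0.le (by linarith); linarith
  rw [le_div_iff₀ (by linarith)]
  have := mul_le_mul_of_nonneg_left hpε hlogq
  linarith
end

section
/- Let V_AB be a bipartite quantum covariance matrix on systems A (2n_A modes coordinates) and B (2n_B coordinates). Then there exists a pure QCM γ on A⊕B with γ ≤ V_AB in the Loewner order and I_M(A:B)_γ ≤ I_M(A:B)_{V_AB}. Consequently the Gaussian Rényi-2 entanglement of formation E^G_{F,2}(A:B)_V := inf{ ½ I_M(A:B)_γ : γ a pure QCM on A⊕B with γ ≤ V_AB } satisfies E^G_{F,2}(A:B)_V ≤ ½ I_M(A:B)_{V_AB}. -/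
open Matrix ComplexOrder

/-- The standard symplectic form on `k` modes. -/
noncomputable def Omega (k : ℕ) : Matrix (Fin 2 × Fin k) (Fin 2 × Fin k) ℝ :=
  Matrix.blockDiagonal fun _ : Fin k => !![(0 : ℝ), 1; -1, 0]

/-- `V` is a quantum covariance matrix with respect to the symplectic form `Ω`:
the complex Hermitian matrix `V + iΩ` is positive semidefinite. -/
def IsQCM {ι : Type} [Fintype ι] [DecidableEq ι] (Ω V : Matrix ι ι ℝ) : Prop :=
  (V.map (fun x => (x : ℂ)) + Complex.I • Ω.map (fun x => (x : ℂ))).PosSemidef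

/-- Log-det mutual information `I_M(A:B)_V = ½ ln(det V_A · det V_B / det V)`. -/
noncomputable def IM {ι κ : Type} [Fintype ι] [DecidableEq ι] [Fintype κ] [DecidableEq κ]
    (V : Matrix (ι ⊕ κ) (ι ⊕ κ) ℝ) : ℝ :=
  (1 / 2 : ℝ) * Real.log ((V.toBlocks₁₁.det * V.toBlocks₂₂.det) / V.det)

section helpers
open scoped MatrixOrder

variable {ι κ : Type} [Fintype ι] [DecidableEq ι] [Fintype κ] [DecidableEq κ]

theorem exists_psd_sqrt (A : Matrix ι ι ℝ) (hA : A.PosSemidef) :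
    ∃ S : Matrix ι ι ℝ, S.PosSemidef ∧ S * S = A ∧ ∀ X, Commute A X → Commute S X := by
  refine ⟨CFC.sqrt A, Matrix.nonneg_iff_posSemidef.1 (CFC.sqrt_nonneg A), CFC.sqrt_mul_sqrt_self A hA.nonneg, ?_⟩
  intro X hX
  exact Commute.cfcₙ_nnreal hX _

theorem posDef_of_psd_det {A : Matrix ι ι ℝ} (hA : A.PosSemidef) (h : A.det ≠ 0) : A.PosDef := by
  exact hA.posDef_iff_det_ne_zero.mpr h

theorem exists_pd_sqrt (A : Matrix ι ι ℝ) (hA : A.PosDef) :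
    ∃ S : Matrix ι ι ℝ, S.PosDef ∧ S * S = A ∧ ∀ X, Commute A X → Commute S X := by
  obtain ⟨S, h1, h2, h3⟩ := exists_psd_sqrt A hA.posSemidef
  refine ⟨S, posDef_of_psd_det h1 ?_, h2, h3⟩
  intro h
  have := hA.det_pos
  rw [← h2, det_mul, h] at this
  simp at this

theorem one_le_det_one_add {P : Matrix ι ι ℝ} (hP : P.PosSemidef) : 1 ≤ (1 + P).det := by
  have h := hP.1.spectral_theorem
  have hu := Unitary.mul_star_self_of_mem hP.1.eigenvectorUnitary.2
  set U : Matrix ι ι ℝ := ↑hP.1.eigenvectorUnitary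
  have h2 : 1 + P = U * (1 + diagonal hP.1.eigenvalues) * star U := by
    rw [mul_add, add_mul, mul_one, hu]
    congr 1
  rw [h2, det_mul, det_mul, mul_right_comm, ← det_mul, hu, det_one, one_mul,
    ← diagonal_one, diagonal_add, det_diagonal]
  apply Finset.one_le_prod
  intro i _
  have := hP.eigenvalues_nonneg i
  simpa using this

theorem det_mono' {A B : Matrix ι ι ℝ} (hA : A.PosDef) (h : (B - A).PosSemidef) :
    A.det ≤ B.det := by
  obtain ⟨S, h1, h2, -⟩ := exists_pd_sqrt A hA
  have hu : IsUnit S.det := h1.det_pos.ne'.isUnit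
  have hB : B = S * (1 + S⁻¹ * (B - A) * S⁻¹) * S := by
    have e1 : S * (S⁻¹ * (B - A) * S⁻¹) * S = B - A := by
      rw [mul_assoc S⁻¹, mul_nonsing_inv_cancel_left _ _ hu, nonsing_inv_mul_cancel_right _ _ hu]
    rw [mul_add, add_mul, e1, mul_one, h2]; abel
  have hp : (S⁻¹ * (B - A) * S⁻¹).PosSemidef := by
    have := h.mul_mul_conjTranspose_same S⁻¹
    rwa [h1.inv.1.eq] at this
  have := one_le_det_one_add hp
  have hd : B.det = S.det * (1 + S⁻¹ * (B - A) * S⁻¹).det * S.det := by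
    rw [← det_mul, ← det_mul, ← hB]
  rw [hd, ← h2, det_mul, h2]
  nlinarith [mul_pos h1.det_pos h1.det_pos]

theorem block_det {m : Type} [Fintype m] [DecidableEq m] {V γ W : Matrix ι ι ℝ} (hV : V.PosDef)
    (hγ : γ.PosDef) (hW : γ * V⁻¹ * γ = W) (f : m → ι) (hf : Function.Injective f) :
    (γ.submatrix f f).det ^ 2 ≤ (V.submatrix f f).det * (W.submatrix f f).det := by
  have hVf : (V.submatrix f f).PosDef := hV.submatrix hf
  have hγf : (γ.submatrix f f).PosDef := hγ.submatrix hf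
  have := hV.isUnit.invertible
  have := hVf.isUnit.invertible
  have h1 : (fromBlocks V γ γᴴ W).PosSemidef := by
    rw [PosDef.fromBlocks₁₁ _ _ hV, hγ.1.eq, hW, sub_self]
    exact PosSemidef.zero
  have h2 := h1.submatrix (Sum.map f f)
  have h3 : (fromBlocks V γ γᴴ W).submatrix (Sum.map f f) (Sum.map f f) =
      fromBlocks (V.submatrix f f) (γ.submatrix f f) (γ.submatrix f f)ᴴ (W.submatrix f f) := by
    ext (i | i) (j | j) <;> rfl
  rw [h3, PosDef.fromBlocks₁₁ _ _ hVf, hγf.1.eq] at h2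
  have hpd : (γ.submatrix f f * (V.submatrix f f)⁻¹ * γ.submatrix f f).PosDef := by
    apply posDef_of_psd_det
    · have := hVf.inv.posSemidef.mul_mul_conjTranspose_same (γ.submatrix f f)
      rwa [hγf.1.eq] at this
    · rw [det_mul, det_mul]
      have := hγf.det_pos
      have := hVf.inv.det_pos
      positivity
  have h4 := det_mono' hpd h2
  rw [det_mul, det_mul, det_nonsing_inv, Ring.inverse_eq_inv'] at h4
  have h5 := hVf.det_pos
  calc _ = (V.submatrix f f).det * ((γ.submatrix f f).det * (V.submatrix f f).det⁻¹ *
      (γ.submatrix f f).det) := by field_simp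
    _ ≤ _ := by gcongr

theorem inv_block₁₁ {V : Matrix (ι ⊕ κ) (ι ⊕ κ) ℝ} (h : IsUnit V.det) :
    V.det * V⁻¹.toBlocks₁₁.det = V.toBlocks₂₂.det := by
  have e := mul_nonsing_inv V h
  rw [← fromBlocks_toBlocks V, ← fromBlocks_toBlocks (fromBlocks _ _ _ _)⁻¹,
    fromBlocks_multiply, ← fromBlocks_one, fromBlocks_inj, fromBlocks_toBlocks] at e
  have : V * fromBlocks V⁻¹.toBlocks₁₁ 0 V⁻¹.toBlocks₂₁ 1 =
      fromBlocks 1 V.toBlocks₁₂ 0 V.toBlocks₂₂ := by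
    conv_lhs => rw [← fromBlocks_toBlocks V, fromBlocks_multiply, fromBlocks_toBlocks]
    rw [e.1, e.2.2.1]; simp
  have := congrArg det this
  simpa [det_fromBlocks_zero₁₂, det_fromBlocks_zero₂₁] using this

theorem inv_block₂₂ {V : Matrix (ι ⊕ κ) (ι ⊕ κ) ℝ} (h : IsUnit V.det) :
    V.det * V⁻¹.toBlocks₂₂.det = V.toBlocks₁₁.det := by
  have e := mul_nonsing_inv V h
  rw [← fromBlocks_toBlocks V, ← fromBlocks_toBlocks (fromBlocks _ _ _ _)⁻¹,
    fromBlocks_multiply, ← fromBlocks_one, fromBlocks_inj, fromBlocks_toBlocks] at e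
  have : V * fromBlocks 1 V⁻¹.toBlocks₁₂ 0 V⁻¹.toBlocks₂₂ =
      fromBlocks V.toBlocks₁₁ 0 V.toBlocks₂₁ 1 := by
    conv_lhs => rw [← fromBlocks_toBlocks V, fromBlocks_multiply, fromBlocks_toBlocks]
    rw [e.2.1, e.2.2.2]; simp
  have := congrArg det this
  simpa [det_fromBlocks_zero₁₂, det_fromBlocks_zero₂₁] using this

theorem fischer {V : Matrix (ι ⊕ κ) (ι ⊕ κ) ℝ} (h : V.PosDef) :
    V.det ≤ V.toBlocks₁₁.det * V.toBlocks₂₂.det := by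
  have h1 : V.toBlocks₁₁.PosDef := h.submatrix (e := Sum.inl) Sum.inl_injective
  have h2 : V.toBlocks₂₂.PosDef := h.submatrix (e := Sum.inr) Sum.inr_injective
  have h3 : V⁻¹.toBlocks₁₁.PosDef := h.inv.submatrix (e := Sum.inl) Sum.inl_injective
  have := h1.isUnit.invertible
  have := h.isUnit.invertible
  have hb : V.toBlocks₁₂ᴴ = V.toBlocks₂₁ := by
    ext i j
    exact h.1.apply (Sum.inr i) (Sum.inl j)
  have hd : V.det = V.toBlocks₁₁.det *
      (V.toBlocks₂₂ - V.toBlocks₂₁ * V.toBlocks₁₁⁻¹ * V.toBlocks₁₂).det := by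
    conv_lhs => rw [← fromBlocks_toBlocks V, det_fromBlocks₁₁, invOf_eq_nonsing_inv]
  have hs : (V.toBlocks₂₂ - V.toBlocks₂₁ * V.toBlocks₁₁⁻¹ * V.toBlocks₁₂).PosSemidef := by
    have := (PosDef.fromBlocks₁₁ V.toBlocks₁₂ V.toBlocks₂₂ h1).1
      (by rw [hb, fromBlocks_toBlocks]; exact h.posSemidef)
    rwa [hb] at this
  have hp := h.det_pos
  have hp1 := h1.det_pos
  rw [hd]
  gcongr
  refine det_mono' (posDef_of_psd_det hs ?_) ?_
  · intro h0; rw [hd, h0] at hp; simp at hp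
  · rw [sub_sub_cancel]
    have := h1.inv.posSemidef.conjTranspose_mul_mul_same V.toBlocks₁₂
    rwa [hb] at this

end helpers

section helpers2

variable {ι κ : Type} [Fintype ι] [DecidableEq ι] [Fintype κ] [DecidableEq κ]

noncomputable def toC : Matrix ι ι ℝ →+* Matrix ι ι ℂ := Complex.ofRealHom.mapMatrix

theorem toC_apply (M : Matrix ι ι ℝ) (i j : ι) : toC M i j = (M i j : ℂ) := rfl

theorem isQCM_iff (Ω V : Matrix ι ι ℝ) :
    IsQCM Ω V ↔ (toC V + Complex.I • toC Ω).PosSemidef := Iff.rfl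

theorem toC_conjTranspose (M : Matrix ι ι ℝ) : (toC M)ᴴ = toC Mᵀ := by
  ext i j
  simp [toC_apply]

theorem toC_transpose (M : Matrix ι ι ℝ) : (toC M)ᵀ = toC Mᵀ := rfl

theorem toC_psd {M : Matrix ι ι ℝ} (h : M.PosSemidef) : (toC M).PosSemidef := by
  obtain ⟨S, h1, h2, -⟩ := exists_psd_sqrt M h
  have := posSemidef_conjTranspose_mul_self (toC S)
  have e : Sᵀ = S := h1.1
  rwa [toC_conjTranspose, ← map_mul, e, h2] at this

theorem psd_of_toC {M : Matrix ι ι ℝ} (h : (toC M).PosSemidef) : M.PosSemidef := by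
  refine PosSemidef.of_dotProduct_mulVec_nonneg ?_ ?_
  · ext i j
    have := h.1.apply i j
    simpa [toC_apply] using this
  · intro x
    have h2 := h.dotProduct_mulVec_nonneg (fun i => (x i : ℂ))
    have e : star (fun i => (x i : ℂ)) ⬝ᵥ (toC M *ᵥ fun i => (x i : ℂ)) =
        ((star x ⬝ᵥ (M *ᵥ x) : ℝ) : ℂ) := by
      simp [dotProduct, mulVec, toC_apply]
    rw [e] at h2
    exact_mod_cast h2

theorem qcm_posDef {Ω V : Matrix ι ι ℝ} (hT : Ωᵀ = -Ω) (hΩ : Ω * Ω = -1) (hV : IsQCM Ω V) :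
    V.PosDef := by
  rw [isQCM_iff] at hV
  have hV' := hV.transpose
  have hVt : V.PosSemidef := by
    have hre : Vᵀ = V := by
      ext i j
      have := congrArg Complex.re (hV.1.apply i j)
      have hh := congrArg Complex.re (hV.1.apply i j)
      simpa [toC_apply] using this
    rw [transpose_add, transpose_smul, toC_transpose, toC_transpose, hT, hre] at hV'
    apply psd_of_toC
    have h2 := (hV.add hV').smul (a := (1/2 : ℝ)) (by norm_num)
    convert h2 using 1
    rw [map_neg]
    ext i j
    simp [toC_apply]
    ring
  refine PosDef.of_dotProduct_mulVec_pos hVt.1 ?_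
  intro x hx
  refine lt_of_le_of_ne (hVt.dotProduct_mulVec_nonneg x) ?_
  intro h0
  have h1 := (hVt.dotProduct_mulVec_zero_iff x).1 h0.symm
  apply hx
  set z : ι → ℂ := fun i => (x i : ℂ) with hz
  have hm : ∀ M : Matrix ι ι ℝ, toC M *ᵥ z = fun i => ((M *ᵥ x) i : ℂ) := by
    intro M; ext i; simp [mulVec, dotProduct, toC_apply, hz]
  have hskew : x ⬝ᵥ (Ω *ᵥ x) = 0 := by
    have e1 : x ⬝ᵥ (Ω *ᵥ x) = x ⬝ᵥ (Ωᵀ *ᵥ x) := by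
      rw [mulVec_transpose, dotProduct_mulVec, dotProduct_comm]
    rw [hT, neg_mulVec, dotProduct_neg] at e1
    linarith
  have hstar : star z ⬝ᵥ (toC Ω *ᵥ z) = ((x ⬝ᵥ (Ω *ᵥ x) : ℝ) : ℂ) := by
    rw [hm]; simp [dotProduct, hz]
  have h2 : (toC V + Complex.I • toC Ω) *ᵥ z = 0 := by
    rw [← hV.dotProduct_mulVec_zero_iff, add_mulVec, smul_mulVec, dotProduct_add, dotProduct_smul,
      hstar, hskew, hm V, h1]
    simp [dotProduct]
  rw [add_mulVec, smul_mulVec, hm, hm, h1] at h2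
  have h3 : Ω *ᵥ x = 0 := by
    ext i
    have := congrFun h2 i
    simpa using this
  have h4 : Ω *ᵥ (Ω *ᵥ x) = 0 := by rw [h3, mulVec_zero]
  rw [mulVec_mulVec, hΩ, neg_mulVec, one_mulVec] at h4
  simpa using h4

theorem psd_conj {M S : Matrix ι ι ℝ} (h : M.PosSemidef) (hS : Sᵀ = S) :
    (S * M * S).PosSemidef := by
  have := h.mul_mul_conjTranspose_same S
  rwa [conjTranspose_eq_transpose_of_trivial, hS] at this

theorem qcm_conj {Ω V S : Matrix ι ι ℝ} (h : IsQCM Ω V) (hS : Sᵀ = S) :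
    IsQCM (S * Ω * S) (S * V * S) := by
  rw [isQCM_iff] at *
  have := h.mul_mul_conjTranspose_same (toC S)
  rw [toC_conjTranspose, hS] at this
  convert this using 1
  simp [map_mul, mul_add, add_mul]

theorem one_add_sq_psd {N : Matrix ι ι ℝ} (hT : Nᵀ = -N) (h : IsQCM N 1) :
    (1 + N * N).PosSemidef := by
  rw [isQCM_iff, map_one] at h
  have h' := h.transpose
  rw [transpose_add, transpose_smul, toC_transpose, hT, map_neg, transpose_one, smul_neg,
    ← sub_eq_add_neg] at h'
  set H : Matrix ι ι ℂ := Complex.I • toC N with hH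
  have hHH : H * H = - toC (N * N) := by
    rw [hH, map_mul, smul_mul_assoc, mul_smul_comm, smul_smul, Complex.I_mul_I]; simp
  have a := h'.mul_mul_conjTranspose_same (1 + H)
  have b := h.mul_mul_conjTranspose_same (1 - H)
  rw [h.1.eq] at a
  rw [h'.1.eq] at b
  apply psd_of_toC
  have hab := (a.add b).smul (a := (1/2 : ℝ)) (by norm_num)
  have e : (1 + H) * (1 - H) * (1 + H) + (1 - H) * (1 + H) * (1 - H) = (2 : ℝ) • (1 - H * H) := by
    rw [two_smul]; noncomm_ring
  rw [e, smul_smul, hHH, sub_neg_eq_add] at hab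
  rw [map_add, map_one]
  norm_num at hab
  simpa using hab

theorem abs_qcm {N P : Matrix ι ι ℝ} (hT : Nᵀ = -N) (hP : P.PosDef) (hPP : P * P = -(N * N))
    (hc : Commute P N) : IsQCM N P := by
  rw [isQCM_iff]
  set H : Matrix ι ι ℂ := Complex.I • toC N with hH
  have hHH : H * H = toC P * toC P := by
    rw [← map_mul, hPP, hH, smul_mul_assoc, mul_smul_comm, smul_smul, Complex.I_mul_I, ← map_mul]
    simp
  have hcH : toC P * H = H * toC P := by
    rw [hH, mul_smul_comm, smul_mul_assoc, ← map_mul, hc.eq, map_mul]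
  have hherm : (toC P + H)ᴴ = toC P + H := by
    have e : Pᵀ = P := hP.1
    rw [conjTranspose_add, hH, conjTranspose_smul, toC_conjTranspose, toC_conjTranspose, hT, e]
    simp
  have hinv : toC P * toC P⁻¹ = 1 := by
    rw [← map_mul, mul_nonsing_inv _ hP.det_pos.ne'.isUnit, map_one]
  have hinv' : toC P⁻¹ * toC P = 1 := by
    rw [← map_mul, nonsing_inv_mul _ hP.det_pos.ne'.isUnit, map_one]
  have a := (toC_psd hP.inv.posSemidef).mul_mul_conjTranspose_same (toC P + H)
  rw [hherm] at a
  have hcI : H * toC P⁻¹ = toC P⁻¹ * H := by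
    calc H * toC P⁻¹ = toC P⁻¹ * (toC P * H) * toC P⁻¹ := by rw [← mul_assoc, hinv', one_mul]
      _ = toC P⁻¹ * H := by rw [hcH, mul_assoc, mul_assoc, hinv, mul_one]
  have e : (toC P + H) * toC P⁻¹ * (toC P + H) = (2 : ℝ) • (toC P + H) := by
    rw [add_mul, hinv, hcI, add_mul, one_mul, mul_assoc, mul_add, hHH, ← hcH, ← mul_add,
      ← mul_assoc, hinv', one_mul, two_smul, add_comm H]
  rw [e] at a
  have := a.smul (a := (1/2 : ℝ)) (by norm_num)
  rw [smul_smul] at this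
  norm_num at this
  exact this

theorem core {Ω V : Matrix ι ι ℝ} (hT : Ωᵀ = -Ω) (hΩ : Ω * Ω = -1) (hV : IsQCM Ω V) :
    ∃ γ : Matrix ι ι ℝ, IsQCM Ω γ ∧ γ.det = 1 ∧ (V - γ).PosSemidef ∧ γ.PosDef ∧
      γ * V⁻¹ * γ = Ωᵀ * V⁻¹ * Ω := by
  have hVp := qcm_posDef hT hΩ hV
  obtain ⟨S, hS, hSS, -⟩ := exists_pd_sqrt V hVp
  have hSt : Sᵀ = S := hS.1
  have hRt : S⁻¹ᵀ = S⁻¹ := hS.inv.1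
  have hu : IsUnit S.det := hS.det_pos.ne'.isUnit
  have hSR := mul_nonsing_inv _ hu
  have hRS := nonsing_inv_mul _ hu
  have hVi : V⁻¹ = S⁻¹ * S⁻¹ := by rw [← hSS, Matrix.mul_inv_rev]
  set R := S⁻¹ with hR
  set N := R * Ω * R with hN
  have hNt : Nᵀ = -N := by
    rw [hN, transpose_mul, transpose_mul, hRt, hT]; noncomm_ring
  have hSNS : S * N * S = Ω := by
    calc S * N * S = (S * R) * Ω * (R * S) := by rw [hN]; noncomm_ring
      _ = Ω := by rw [hSR, hRS, one_mul, mul_one]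
  have hQ : IsQCM N 1 := by
    have := qcm_conj hV hRt
    have e : R * V * R = 1 := by
      calc R * V * R = (R * S) * (S * R) := by rw [← hSS]; noncomm_ring
        _ = 1 := by rw [hSR, hRS, one_mul]
    rwa [e] at this
  have h1N := one_add_sq_psd hNt hQ
  have hdΩ : Ω.det * Ω.det = 1 := by
    have := congrArg det (show Ωᵀ * Ω = 1 by rw [hT, neg_mul, hΩ, neg_neg])
    rwa [det_mul, det_transpose, det_one] at this
  have hA : (-(N * N)).PosDef := by
    apply posDef_of_psd_det
    · have := posSemidef_conjTranspose_mul_self N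
      rwa [conjTranspose_eq_transpose_of_trivial, hNt, neg_mul] at this
    · have e : -(N * N) = Nᵀ * N := by rw [hNt, neg_mul]
      rw [e, det_mul, det_transpose, hN, det_mul, det_mul]
      have := hS.inv.det_pos.ne'
      have : Ω.det ≠ 0 := by rintro h; rw [h] at hdΩ; simp at hdΩ
      positivity
  obtain ⟨P, hP, hPP, hPc⟩ := exists_pd_sqrt _ hA
  have hcomm : Commute P N := hPc N (((Commute.refl N).mul_left (Commute.refl N)).neg_left)
  have hPt : Pᵀ = P := hP.1
  have h1P : (1 - P).PosSemidef := by
    have a := posSemidef_conjTranspose_mul_self (1 - P)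
    rw [conjTranspose_eq_transpose_of_trivial, transpose_sub, transpose_one, hPt] at a
    convert (a.add h1N).smul (a := (1/2 : ℝ)) (by norm_num) using 1
    have e : (1 - P) * (1 - P) + (1 + N * N) = (2 : ℝ) • (1 - P) := by
      rw [two_smul, show N * N = - (P * P) by rw [hPP, neg_neg]]; noncomm_ring
    rw [e, smul_smul]; norm_num
  have hγp : (S * P * S).PosDef := by
    apply posDef_of_psd_det (psd_conj hP.posSemidef hSt)
    rw [det_mul, det_mul]
    have := hS.det_pos
    have := hP.det_pos
    positivity
  have hrel : (S * P * S) * V⁻¹ * (S * P * S) = Ωᵀ * V⁻¹ * Ω := by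
    calc (S * P * S) * V⁻¹ * (S * P * S) = S * P * (S * R) * (R * S) * P * S := by
          rw [hVi]; noncomm_ring
      _ = S * (P * P) * S := by rw [hSR, hRS]; noncomm_ring
      _ = -((S * R) * Ω * R * R * Ω * (R * S)) := by rw [hPP, hN]; noncomm_ring
      _ = Ωᵀ * V⁻¹ * Ω := by rw [hSR, hRS, hVi, hT]; noncomm_ring
  refine ⟨S * P * S, ?_, ?_, ?_, hγp, hrel⟩
  · have := qcm_conj (abs_qcm hNt hP hPP hcomm) hSt
    rwa [hSNS] at this
  · have h := congrArg det hrel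
    rw [det_mul, det_mul _ V⁻¹, det_mul (Ωᵀ * V⁻¹), det_mul Ωᵀ, det_transpose] at h
    have h2 := hVp.inv.det_pos
    have h3 := hγp.det_pos
    have h4 : (S * P * S).det * (S * P * S).det = 1 := by
      apply mul_right_cancel₀ h2.ne'
      linear_combination h + V⁻¹.det * hdΩ
    nlinarith
  · have := psd_conj h1P hSt
    convert this using 1
    rw [← hSS]; noncomm_ring

theorem Omega_transpose (k : ℕ) : (Omega k)ᵀ = -Omega k := by
  rw [Omega, blockDiagonal_transpose, ← blockDiagonal_neg]
  congr 1
  ext _ i j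
  fin_cases i <;> fin_cases j <;> simp

theorem Omega_sq (k : ℕ) : Omega k * Omega k = -1 := by
  rw [Omega, ← blockDiagonal_mul, ← blockDiagonal_one, ← blockDiagonal_neg]
  congr 1
  ext _ i j
  fin_cases i <;> fin_cases j <;> simp

theorem Omega_det_sq (k : ℕ) : (Omega k).det * (Omega k).det = 1 := by
  have := congrArg det (show (Omega k)ᵀ * Omega k = 1 by
    rw [Omega_transpose, neg_mul, Omega_sq, neg_neg])
  rwa [det_mul, det_transpose, det_one] at this

theorem IM_nonneg_aux {V : Matrix (ι ⊕ κ) (ι ⊕ κ) ℝ} (h : V.PosDef) : 0 ≤ IM V := by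
  unfold IM
  have : 1 ≤ V.toBlocks₁₁.det * V.toBlocks₂₂.det / V.det := by
    rw [le_div_iff₀ h.det_pos, one_mul]; exact fischer h
  have := Real.log_nonneg this
  positivity

end helpers2

/-- **The Gaussian Rényi-2 entanglement of formation is at most half the log-det mutual
information.** For every bipartite QCM `V_AB` there is a pure QCM `γ ≤ V_AB` with
`I_M(A:B)_γ ≤ I_M(A:B)_{V_AB}`; consequently
`E^G_{F,2}(A:B)_V = inf{ ½ I_M(A:B)_γ : γ pure QCM, γ ≤ V_AB } ≤ ½ I_M(A:B)_{V_AB}`. -/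
theorem gaussian_eof_le_half_IM (nA nB : ℕ)
    (V : Matrix ((Fin 2 × Fin nA) ⊕ (Fin 2 × Fin nB)) ((Fin 2 × Fin nA) ⊕ (Fin 2 × Fin nB)) ℝ)
    (hV : IsQCM (fromBlocks (Omega nA) 0 0 (Omega nB)) V) :
    (∃ γ : Matrix ((Fin 2 × Fin nA) ⊕ (Fin 2 × Fin nB)) ((Fin 2 × Fin nA) ⊕ (Fin 2 × Fin nB)) ℝ,
        IsQCM (fromBlocks (Omega nA) 0 0 (Omega nB)) γ ∧ γ.det = 1 ∧
          (V - γ).PosSemidef ∧ IM γ ≤ IM V)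
    ∧ sInf {x : ℝ |
          ∃ γ : Matrix ((Fin 2 × Fin nA) ⊕ (Fin 2 × Fin nB))
              ((Fin 2 × Fin nA) ⊕ (Fin 2 × Fin nB)) ℝ,
            IsQCM (fromBlocks (Omega nA) 0 0 (Omega nB)) γ ∧ γ.det = 1 ∧
              (V - γ).PosSemidef ∧ x = (1 / 2 : ℝ) * IM γ}
        ≤ (1 / 2 : ℝ) * IM V := by
  have hT : (fromBlocks (Omega nA) 0 0 (Omega nB))ᵀ = -fromBlocks (Omega nA) 0 0 (Omega nB) := by
    simp [fromBlocks_transpose, fromBlocks_neg, Omega_transpose]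
  have hΩ : fromBlocks (Omega nA) 0 0 (Omega nB) * fromBlocks (Omega nA) 0 0 (Omega nB) = -1 := by
    rw [fromBlocks_multiply, ← fromBlocks_one, fromBlocks_neg]
    simp [Omega_sq]
  have hVp := qcm_posDef hT hΩ hV
  obtain ⟨γ, h1, h2, h3, hγ, hrel⟩ := core hT hΩ hV
  have hIM : IM γ ≤ IM V := by
    have hA := block_det hVp hγ hrel Sum.inl Sum.inl_injective
    have hB := block_det hVp hγ hrel Sum.inr Sum.inr_injective
    have hWA : ((fromBlocks (Omega nA) 0 0 (Omega nB))ᵀ * V⁻¹ *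
        fromBlocks (Omega nA) 0 0 (Omega nB)).submatrix Sum.inl Sum.inl =
        (Omega nA)ᵀ * V⁻¹.toBlocks₁₁ * Omega nA := by
      rw [← fromBlocks_toBlocks V⁻¹, fromBlocks_transpose, fromBlocks_multiply,
        fromBlocks_multiply]
      ext i j
      simp
    have hWB : ((fromBlocks (Omega nA) 0 0 (Omega nB))ᵀ * V⁻¹ *
        fromBlocks (Omega nA) 0 0 (Omega nB)).submatrix Sum.inr Sum.inr =
        (Omega nB)ᵀ * V⁻¹.toBlocks₂₂ * Omega nB := by
      rw [← fromBlocks_toBlocks V⁻¹, fromBlocks_transpose, fromBlocks_multiply,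
        fromBlocks_multiply]
      ext i j
      simp
    rw [hWA, det_mul, det_mul, det_transpose, mul_right_comm (Omega nA).det, Omega_det_sq,
      one_mul] at hA
    rw [hWB, det_mul, det_mul, det_transpose, mul_right_comm (Omega nB).det, Omega_det_sq,
      one_mul] at hB
    have hu : IsUnit V.det := hVp.det_pos.ne'.isUnit
    have eA := inv_block₁₁ hu
    have eB := inv_block₂₂ hu
    have pA : 0 < V.toBlocks₁₁.det :=
      (hVp.submatrix (e := Sum.inl) Sum.inl_injective : V.toBlocks₁₁.PosDef).det_pos
    have pB : 0 < V.toBlocks₂₂.det :=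
      (hVp.submatrix (e := Sum.inr) Sum.inr_injective : V.toBlocks₂₂.PosDef).det_pos
    have gA : 0 < γ.toBlocks₁₁.det :=
      (hγ.submatrix (e := Sum.inl) Sum.inl_injective : γ.toBlocks₁₁.PosDef).det_pos
    have gB : 0 < γ.toBlocks₂₂.det :=
      (hγ.submatrix (e := Sum.inr) Sum.inr_injective : γ.toBlocks₂₂.PosDef).det_pos
    change γ.toBlocks₁₁.det ^ 2 ≤ V.toBlocks₁₁.det * V⁻¹.toBlocks₁₁.det at hA
    change γ.toBlocks₂₂.det ^ 2 ≤ V.toBlocks₂₂.det * V⁻¹.toBlocks₂₂.det at hB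
    have pV := hVp.det_pos
    rw [mul_comm, ← eq_div_iff pV.ne'] at eA eB
    rw [eA] at hA
    rw [eB] at hB
    have key : γ.toBlocks₁₁.det * γ.toBlocks₂₂.det ≤
        V.toBlocks₁₁.det * V.toBlocks₂₂.det / V.det := by
      refine (sq_le_sq₀ (by positivity) (by positivity)).1 ?_
      calc _ = γ.toBlocks₁₁.det ^ 2 * γ.toBlocks₂₂.det ^ 2 := by ring
        _ ≤ _ := mul_le_mul hA hB (by positivity) (by positivity)
        _ = _ := by ring
    unfold IM
    rw [h2, div_one]
    have := Real.log_le_log (mul_pos gA gB) key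
    linarith
  refine ⟨⟨γ, h1, h2, h3, hIM⟩, ?_⟩
  calc _ ≤ (1 / 2 : ℝ) * IM γ := by
        apply csInf_le
        · refine ⟨0, ?_⟩
          rintro x ⟨g, hg, -, -, rfl⟩
          have := IM_nonneg_aux (qcm_posDef hT hΩ hg)
          positivity
        · exact ⟨γ, h1, h2, h3, rfl⟩
    _ ≤ _ := by linarith
end

section
/- Let V_AB be a bipartite quantum covariance matrix on A⊕B (blocks of sizes 2n_A, 2n_B). Define the Gaussian Rényi-2 entanglement of formation E^G_{F,2}(V_AB) := inf{ ½ I_M(A:B)_γ : γ a pure QCM on A⊕B with γ ≤ V_AB } and the Gaussian Rényi-2 squashed entanglement E^G_{sq,2}(V_AB) := inf{ ½ I_M(A:B|C)_W : m ∈ ℕ and W a QCM on A⊕B⊕C, where C carries m modes (size 2m), whose principal submatrix on A⊕B equals V_AB } (for m = 0 the quantity ½ I_M(A:B|C)_W is interpreted as ½ I_M(A:B)_W). Both infima are over nonempty sets of nonnegative reals, and they coincide: E^G_{sq,2}(V_AB) = E^G_{F,2}(V_AB). -/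
open Matrix ComplexOrder

/-- Log-det conditional mutual information
`I_M(A:B|C)_W = ½ ln(det W_AC · det W_BC / (det W_C · det W))` of a tripartite matrix
on `(ιA ⊕ ιB) ⊕ ιC`.  (For `ιC` empty this reduces to `I_M(A:B)`.) -/
noncomputable def ICM {ιA ιB ιC : Type} [Fintype ιA] [DecidableEq ιA]
    [Fintype ιB] [DecidableEq ιB] [Fintype ιC] [DecidableEq ιC]
    (W : Matrix ((ιA ⊕ ιB) ⊕ ιC) ((ιA ⊕ ιB) ⊕ ιC) ℝ) : ℝ :=
  (1 / 2 : ℝ) * Real.log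
    (((W.submatrix (Sum.elim (Sum.inl ∘ Sum.inl) Sum.inr)
          (Sum.elim (Sum.inl ∘ Sum.inl) Sum.inr)).det *
        (W.submatrix (Sum.elim (Sum.inl ∘ Sum.inr) Sum.inr)
          (Sum.elim (Sum.inl ∘ Sum.inr) Sum.inr)).det) /
      ((W.submatrix Sum.inr Sum.inr).det * W.det))


section Helpers

variable {ι κ : Type} [Fintype ι] [DecidableEq ι] [Fintype κ] [DecidableEq κ]

lemma aux_det_one_add {M : Matrix ι ι ℝ} (hM : M.PosSemidef) : 1 ≤ (1 + M).det := by
  have h := hM.1.spectral_theorem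
  set U : Matrix ι ι ℝ := (hM.1.eigenvectorUnitary : Matrix ι ι ℝ) with hU
  have hUU : U * star U = 1 := by simp [hU]
  have hUU' : star U * U = 1 := by simp [hU]
  rw [Unitary.conjStarAlgAut_apply] at h
  have h2 : 1 + M = U * (diagonal (fun i => 1 + hM.1.eigenvalues i)) * star U := by
    rw [← diagonal_add, diagonal_one, mul_add, add_mul, mul_one, hUU]
    exact congrArg (1 + ·) h
  rw [h2, det_mul_right_comm, hUU, one_mul, det_diagonal]
  have : ∀ i ∈ Finset.univ, (1 : ℝ) ≤ 1 + hM.1.eigenvalues i := fun i _ => by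
    have := hM.eigenvalues_nonneg i
    linarith
  simpa using Finset.prod_le_prod (f := fun _ => (1 : ℝ)) (fun _ _ => zero_le_one) this

lemma aux_psd_factor {P : Matrix ι ι ℝ} (hP : P.PosSemidef) : ∃ B : Matrix ι ι ℝ, P = Bᵀ * B := by
  open scoped MatrixOrder in
  obtain ⟨B, hB⟩ := CStarAlgebra.nonneg_iff_eq_star_mul_self.mp hP.nonneg
  exact ⟨B, by rw [hB, star_eq_conjTranspose, conjTranspose_eq_transpose_of_trivial]⟩

lemma aux_det_mono {A B : Matrix ι ι ℝ} (hA : A.PosDef) (hAB : (B - A).PosSemidef) :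
    A.det ≤ B.det := by
  obtain ⟨C, hC⟩ := aux_psd_factor hAB
  have hB : B = A + Cᵀ * C := by rw [← hC]; abel
  rw [hB, det_add_mul _ _ hA.det_pos.ne'.isUnit]
  have := aux_det_one_add (hA.inv.posSemidef.mul_mul_conjTranspose_same C)
  rw [conjTranspose_eq_transpose_of_trivial] at this
  nlinarith [hA.det_pos]

lemma aux_map_psd {P : Matrix ι ι ℝ} (hP : P.PosSemidef) :
    (P.map (fun x => (x : ℂ))).PosSemidef := by
  obtain ⟨B, rfl⟩ := aux_psd_factor hP
  have : (Bᵀ * B).map (fun x => (x : ℂ))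
      = (B.map (fun x => (x : ℂ)))ᴴ * (B.map (fun x => (x : ℂ))) := by
    ext i j
    simp [mul_apply]
  rw [this]
  exact posSemidef_conjTranspose_mul_self _

/-- conditions on a symplectic form -/
structure SympForm (Ω : Matrix ι ι ℝ) : Prop where
  skew : Ωᵀ = -Ω
  sq : Ω * Ω = -1

lemma SympForm.det_sq {Ω : Matrix ι ι ℝ} (h : SympForm Ω) : Ω.det * Ω.det = 1 := by
  have : Ω * Ωᵀ = 1 := by rw [h.skew, mul_neg, h.sq, neg_neg]
  have := congrArg det this
  rwa [det_mul, det_transpose, det_one] at this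

lemma aux_omega (k : ℕ) : SympForm (Omega k) := by
  constructor
  · unfold Omega
    rw [blockDiagonal_transpose, ← blockDiagonal_neg]
    congr 1
    funext _
    ext i j
    fin_cases i <;> fin_cases j <;> simp
  · unfold Omega
    rw [← blockDiagonal_mul, ← blockDiagonal_one, ← blockDiagonal_neg]
    congr 1
    funext _
    ext i j
    fin_cases i <;> fin_cases j <;> simp

lemma SympForm.blocks {Ω : Matrix ι ι ℝ} {Ω' : Matrix κ κ ℝ} (h : SympForm Ω) (h' : SympForm Ω') :
    SympForm (fromBlocks Ω 0 0 Ω') := by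
  constructor
  · simp [fromBlocks_transpose, h.skew, h'.skew, fromBlocks_neg]
  · simp [fromBlocks_multiply, h.sq, h'.sq, ← fromBlocks_one, fromBlocks_neg]

/-- real block form of the QCM condition -/
lemma IsQCM.real_psd {Ω W : Matrix ι ι ℝ} (hΩ : SympForm Ω) (h : IsQCM Ω W) :
    (fromBlocks W Ω Ωᵀ W).PosSemidef := by
  have hW : Wᵀ = W := by
    ext i j
    have := congrFun (congrFun h.1 i) j
    have := congrArg Complex.re this
    simpa using this
  refine PosSemidef.of_dotProduct_mulVec_nonneg ?_ ?_
  · rw [IsHermitian, conjTranspose_eq_transpose_of_trivial, fromBlocks_transpose, hW,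
      transpose_transpose]
  · intro z
    obtain ⟨x, y, rfl⟩ : ∃ x y, z = Sum.elim x y := ⟨z ∘ Sum.inl, z ∘ Sum.inr, by simp⟩
    have h1 := h.dotProduct_mulVec_nonneg (fun i => (x i : ℂ) - Complex.I * (y i : ℂ))
    have h2 := (Complex.le_def.mp h1).1
    have key : (star (fun i => (x i : ℂ) - Complex.I * (y i : ℂ)) ⬝ᵥ
        (W.map (fun x => (x : ℂ)) + Complex.I • Ω.map (fun x => (x : ℂ))) *ᵥ
          (fun i => (x i : ℂ) - Complex.I * (y i : ℂ))).re
        = x ⬝ᵥ W *ᵥ x + x ⬝ᵥ Ω *ᵥ y - y ⬝ᵥ Ω *ᵥ x + y ⬝ᵥ W *ᵥ y := by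
      simp only [dotProduct, mulVec, Finset.mul_sum, ← Finset.sum_add_distrib,
        ← Finset.sum_sub_distrib, Complex.re_sum]
      refine Finset.sum_congr rfl fun i _ => Finset.sum_congr rfl fun j _ => ?_
      simp
      ring
    rw [key] at h2
    rw [star_trivial, fromBlocks_mulVec, sumElim_dotProduct_sumElim]
    simp only [Sum.elim_comp_inl, Sum.elim_comp_inr, dotProduct_add, hΩ.skew, neg_mulVec,
      dotProduct_neg]
    simp at h2
    linarith

lemma IsQCM.posDef {Ω W : Matrix ι ι ℝ} (hΩ : SympForm Ω) (h : IsQCM Ω W) : W.PosDef := by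
  have hR := h.real_psd hΩ
  have hW : W.PosSemidef := hR.submatrix Sum.inl
  refine PosDef.of_dotProduct_mulVec_pos hW.1 fun x hx => ?_
  refine lt_of_le_of_ne (hW.dotProduct_mulVec_nonneg x) fun h0 => hx ?_
  have := (hR.dotProduct_mulVec_zero_iff (Sum.elim x 0)).mp (by
    rw [star_trivial, fromBlocks_mulVec, sumElim_dotProduct_sumElim]
    simpa using h0.symm)
  rw [fromBlocks_mulVec] at this
  have h2 : Ωᵀ *ᵥ x = 0 := by
    funext i
    simpa using congrFun this (Sum.inr i)
  have h3 : Ω *ᵥ (Ωᵀ *ᵥ x) = x := by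
    rw [mulVec_mulVec, hΩ.skew, mul_neg, hΩ.sq, neg_neg, one_mulVec]
  rw [← h3, h2, mulVec_zero]

lemma aux_qcm_of_symp {Ω G : Matrix ι ι ℝ} (hΩ : SympForm Ω) (hG : G.PosDef)
    (hs : G * Ω * G = Ω) : IsQCM Ω G := by
  have hu : IsUnit G.det := hG.det_pos.ne'.isUnit
  have hinv : Ω * G⁻¹ * Ω = -G := by
    have h1 : Ω * G⁻¹ = G * Ω := by
      nth_rewrite 1 [← hs]
      rw [mul_assoc, mul_nonsing_inv _ hu, mul_one]
    rw [h1, mul_assoc, hΩ.sq, mul_neg, mul_one]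
  let f : ℝ →+* ℂ := Complex.ofRealHom
  set g := G.map (fun x => (x : ℂ)) with hg
  set w := Ω.map (fun x => (x : ℂ)) with hw
  set gi := (G⁻¹).map (fun x => (x : ℂ)) with hgi
  have m (A B : Matrix ι ι ℝ) : (A * B).map (fun x => (x : ℂ))
      = A.map (fun x => (x : ℂ)) * B.map (fun x => (x : ℂ)) := by
    ext i j; simp [mul_apply]
  have one : (1 : Matrix ι ι ℝ).map (fun x => (x : ℂ)) = 1 := by
    ext i j; simp [one_apply]; split_ifs <;> simp
  have e1 : g * gi = 1 := by rw [hg, hgi, ← m, mul_nonsing_inv _ hu, one]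
  have e2 : gi * g = 1 := by rw [hg, hgi, ← m, nonsing_inv_mul _ hu, one]
  have e3 : w * gi * w = -g := by
    rw [hw, hgi, ← m, ← m, hinv]; ext i j; simp [hg]
  have hH : (g + Complex.I • w)ᴴ = g + Complex.I • w := by
    have hg' : gᴴ = g := by
      ext i j
      have := congrFun (congrFun hG.1 i) j
      simp only [conjTranspose_apply, star_trivial] at this
      simp [hg, this]
    have hw' : wᴴ = -w := by
      ext i j
      have := congrFun (congrFun hΩ.skew i) j
      simp only [transpose_apply] at this
      simp [hw, this]
    rw [conjTranspose_add, conjTranspose_smul, hg', hw']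
    simp
  have h4 : (g + Complex.I • w) * gi * (g + Complex.I • w)ᴴ = (2 : ℝ) • (g + Complex.I • w) := by
    rw [hH]
    have : (g + Complex.I • w) * gi * (g + Complex.I • w)
        = g * gi * g + Complex.I • (g * gi * w) + Complex.I • (w * (gi * g))
          + (Complex.I * Complex.I) • (w * gi * w) := by
      simp only [add_mul, mul_add, smul_mul_assoc, mul_smul_comm, smul_add, smul_smul, mul_assoc]
      abel
    rw [this, e1, e2, e3, Complex.I_mul_I, two_smul]
    simp
    abel
  have h5 := (aux_map_psd hG.inv.posSemidef).mul_mul_conjTranspose_same (g + Complex.I • w)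
  rw [← hgi, h4] at h5
  have h6 := h5.smul (a := (1/2 : ℝ)) (by norm_num)
  rw [smul_smul] at h6
  norm_num at h6
  exact h6

lemma IsQCM.add {Ω G P : Matrix ι ι ℝ} (h : IsQCM Ω G) (hP : P.PosSemidef) : IsQCM Ω (G + P) := by
  have h1 := PosSemidef.add h (aux_map_psd hP)
  unfold IsQCM
  convert h1 using 1
  ext i j
  simp
  ring

lemma aux_fischer {G : Matrix (ι ⊕ κ) (ι ⊕ κ) ℝ} (hG : G.PosDef) :
    G.det ≤ G.toBlocks₁₁.det * G.toBlocks₂₂.det := by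
  have hA : G.toBlocks₁₁.PosDef := hG.submatrix Sum.inl_injective
  have hD : G.toBlocks₂₂.PosDef := hG.submatrix Sum.inr_injective
  have hH : G.toBlocks₁₂ᴴ = G.toBlocks₂₁ := by
    ext i j
    exact congrFun (congrFun hG.1 (Sum.inr i)) (Sum.inl j)
  let _ := hD.isUnit.invertible
  have hS : (G.toBlocks₁₁ - G.toBlocks₁₂ * G.toBlocks₂₂⁻¹ * G.toBlocks₂₁).PosSemidef := by
    rw [← hH, ← PosDef.fromBlocks₂₂ _ _ hD, hH, fromBlocks_toBlocks]
    exact hG.posSemidef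
  have hdet : G.det = G.toBlocks₂₂.det *
      (G.toBlocks₁₁ - G.toBlocks₁₂ * G.toBlocks₂₂⁻¹ * G.toBlocks₂₁).det := by
    conv_lhs => rw [← fromBlocks_toBlocks G]
    rw [det_fromBlocks₂₂, invOf_eq_nonsing_inv]
  have hSd := (hS.posDef_iff_det_ne_zero).mpr (fun h0 => by
    rw [h0, mul_zero] at hdet
    exact hG.det_pos.ne' hdet)
  have := aux_det_mono (B := G.toBlocks₁₁) hSd (by
    rw [sub_sub_cancel, ← hH]
    exact hD.inv.posSemidef.mul_mul_conjTranspose_same _)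
  rw [hdet, mul_comm]
  exact mul_le_mul_of_nonneg_right this hD.det_pos.le

lemma aux_IM_nonneg {G : Matrix (ι ⊕ κ) (ι ⊕ κ) ℝ} (hG : G.PosDef) : 0 ≤ IM G := by
  unfold IM
  have := Real.log_nonneg ((one_le_div hG.det_pos).mpr (aux_fischer hG))
  linarith

/-- The geometric mean of `S` and `Ω S⁻¹ Ωᵀ`. -/
lemma aux_geom {Ω S : Matrix ι ι ℝ} (hΩ : SympForm Ω) (hS : S.PosDef) :
    ∃ G : Matrix ι ι ℝ, G.PosDef ∧ G * Ω * G = Ω ∧ G * S⁻¹ * G = Ω * S⁻¹ * Ωᵀ := by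
  open scoped MatrixOrder in
  obtain ⟨A, hA, hAA⟩ : ∃ A : Matrix ι ι ℝ, A.PosDef ∧ A * A = S := by
    have h := CFC.sqrt_mul_sqrt_self S hS.posSemidef.nonneg
    refine ⟨CFC.sqrt S, ?_, h⟩
    refine ((CFC.sqrt_nonneg S).posSemidef.posDef_iff_det_ne_zero).mpr fun h0 => ?_
    have := congrArg det h
    rw [det_mul, h0, zero_mul] at this
    exact hS.det_pos.ne this
  have hu : IsUnit A.det := hA.det_pos.ne'.isUnit
  have a1 : A * A⁻¹ = 1 := mul_nonsing_inv _ hu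
  have a2 : A⁻¹ * A = 1 := nonsing_inv_mul _ hu
  have hSi : S⁻¹ = A⁻¹ * A⁻¹ := by rw [← hAA, Matrix.mul_inv_rev]
  have hAiT : (A⁻¹)ᵀ = A⁻¹ := by
    have := hA.inv.1
    rwa [IsHermitian, conjTranspose_eq_transpose_of_trivial] at this
  have hAT : Aᵀ = A := by
    have := hA.1
    rwa [IsHermitian, conjTranspose_eq_transpose_of_trivial] at this
  set N := A⁻¹ * Ω * A⁻¹ with hN
  have hNT : Nᵀ = -N := by
    rw [hN, transpose_mul, transpose_mul, hAiT, hΩ.skew]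
    simp [mul_assoc]
  set K := N * Nᵀ with hK
  have hKp : K.PosSemidef := by
    have := posSemidef_self_mul_conjTranspose N
    rwa [conjTranspose_eq_transpose_of_trivial] at this
  have hKdet : K.det ≠ 0 := by
    have h1 : Ω.det ≠ 0 := fun h0 => by
      have := hΩ.det_sq
      simp [h0] at this
    have h2 : (A⁻¹).det ≠ 0 := hA.inv.det_pos.ne'
    rw [hK, det_mul, det_transpose, hN, det_mul, det_mul]
    positivity
  have hQQ := CFC.sqrt_mul_sqrt_self K hKp.nonneg
  have hcomm : Commute K N := by
    rw [hK, hNT]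
    simp [Commute, SemiconjBy, mul_assoc]
  have hQc : Commute (CFC.sqrt K) N := hcomm.cfcₙ_nnreal _
  have hQp : (CFC.sqrt K).PosSemidef := (CFC.sqrt_nonneg K).posSemidef
  set Q := CFC.sqrt K with hQ
  have hQd : Q.PosDef := hQp.posDef_iff_det_ne_zero.mpr fun h0 => by
    have := congrArg det hQQ
    rw [det_mul, h0, zero_mul] at this
    exact hKdet this.symm
  have hQQ' : Q * Q = -(N * N) := by rw [hQQ, hK, hNT, mul_neg]
  -- `Y` is minus the inverse of `N`
  have y1 : (A * Ω * A) * N = -1 := by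
    calc (A * Ω * A) * N = A * Ω * (A * A⁻¹) * Ω * A⁻¹ := by rw [hN]; simp only [mul_assoc]
      _ = A * (Ω * Ω) * A⁻¹ := by rw [a1]; simp only [mul_assoc, one_mul]
      _ = -1 := by rw [hΩ.sq]; simp [a1]
  have y2 : N * (A * Ω * A) = -1 := by
    calc N * (A * Ω * A) = A⁻¹ * Ω * (A⁻¹ * A) * Ω * A := by rw [hN]; simp only [mul_assoc]
      _ = A⁻¹ * (Ω * Ω) * A := by rw [a2]; simp only [mul_assoc, one_mul]
      _ = -1 := by rw [hΩ.sq]; simp [a2]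
  have yc : Q * (A * Ω * A) = (A * Ω * A) * Q := by
    set Y := A * Ω * A
    calc Q * Y = -((-1) * (Q * Y)) := by simp
      _ = -(Y * (N * Q) * Y) := by rw [← y1]; simp only [mul_assoc]
      _ = -(Y * Q * (N * Y)) := by rw [← hQc.eq]; simp only [mul_assoc]
      _ = Y * Q := by rw [y2]; simp
  refine ⟨A * Q * A, ?_, ?_, ?_⟩
  · have h1 := hQd.posSemidef.mul_mul_conjTranspose_same A
    rw [conjTranspose_eq_transpose_of_trivial, hAT] at h1
    refine h1.posDef_iff_det_ne_zero.mpr ?_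
    rw [det_mul, det_mul]
    have := hA.det_pos
    have := hQd.det_pos
    positivity
  · calc A * Q * A * Ω * (A * Q * A) = A * (Q * (A * Ω * A)) * Q * A := by simp only [mul_assoc]
      _ = A * (A * Ω * A) * (Q * Q) * A := by rw [yc]; simp only [mul_assoc]
      _ = -(A * ((A * Ω * A) * N) * N * A) := by rw [hQQ']; simp [mul_assoc]
      _ = A * N * A := by rw [y1]; simp
      _ = (A * A⁻¹) * Ω * (A⁻¹ * A) := by rw [hN]; simp only [mul_assoc]
      _ = Ω := by rw [a1, a2]; simp
  · calc A * Q * A * S⁻¹ * (A * Q * A) = A * Q * (A * A⁻¹) * (A⁻¹ * A) * Q * A := by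
          rw [hSi]; simp only [mul_assoc]
      _ = A * (Q * Q) * A := by rw [a1, a2]; simp [mul_assoc]
      _ = -((A * A⁻¹) * Ω * A⁻¹ * A⁻¹ * Ω * (A⁻¹ * A)) := by
          rw [hQQ', hN]; simp [mul_assoc]
      _ = Ω * S⁻¹ * Ωᵀ := by rw [a1, a2, hSi, hΩ.skew]; simp [mul_assoc]

/-- determinants of compressions of positive block matrices -/
lemma aux_block_det {A G B : Matrix ι ι ℝ} (hA : A.PosDef) (hG : G.PosDef)
    (h : (fromBlocks A G G B).PosSemidef) : G.det * G.det ≤ A.det * B.det := by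
  let _ := hA.isUnit.invertible
  have hGT : Gᴴ = G := hG.1
  have h1 : (fromBlocks A G Gᴴ B).PosSemidef := by rwa [hGT]
  rw [PosDef.fromBlocks₁₁ _ _ hA, hGT] at h1
  have h2 : (G * A⁻¹ * G).PosDef := by
    have h3 := hA.inv.posSemidef.mul_mul_conjTranspose_same G
    rw [hGT] at h3
    refine h3.posDef_iff_det_ne_zero.mpr ?_
    rw [det_mul, det_mul]
    have := hG.det_pos
    have := hA.inv.det_pos
    positivity
  have h4 := aux_det_mono h2 h1
  rw [det_mul, det_mul, det_nonsing_inv, Ring.inverse_eq_inv'] at h4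
  have := hA.det_pos
  calc G.det * G.det = A.det * (G.det * A.det⁻¹ * G.det) := by field_simp
    _ ≤ _ := by gcongr

lemma aux_jacobi₁ {S : Matrix (ι ⊕ κ) (ι ⊕ κ) ℝ} (hS : S.PosDef) :
    S.det * (S⁻¹).toBlocks₁₁.det = S.toBlocks₂₂.det := by
  have h : S * S⁻¹ = 1 := mul_nonsing_inv _ hS.det_pos.ne'.isUnit
  generalize S⁻¹ = Q at h ⊢
  rw [← fromBlocks_toBlocks S, ← fromBlocks_toBlocks Q, fromBlocks_multiply, ← fromBlocks_one, fromBlocks_inj] at h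
  have h2 : S * fromBlocks Q.toBlocks₁₁ 0 Q.toBlocks₂₁ 1
      = fromBlocks 1 S.toBlocks₁₂ 0 S.toBlocks₂₂ := by
    nth_rewrite 1 [← fromBlocks_toBlocks S]
    rw [fromBlocks_multiply, h.1, h.2.2.1]
    simp
  have := congrArg det h2
  simpa using this

lemma aux_jacobi₂ {S : Matrix (ι ⊕ κ) (ι ⊕ κ) ℝ} (hS : S.PosDef) :
    S.det * (S⁻¹).toBlocks₂₂.det = S.toBlocks₁₁.det := by
  have h : S * S⁻¹ = 1 := mul_nonsing_inv _ hS.det_pos.ne'.isUnit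
  generalize S⁻¹ = Q at h ⊢
  rw [← fromBlocks_toBlocks S, ← fromBlocks_toBlocks Q, fromBlocks_multiply, ← fromBlocks_one, fromBlocks_inj] at h
  have h2 : S * fromBlocks 1 Q.toBlocks₁₂ 0 Q.toBlocks₂₂
      = fromBlocks S.toBlocks₁₁ 0 S.toBlocks₂₁ 1 := by
    nth_rewrite 1 [← fromBlocks_toBlocks S]
    rw [fromBlocks_multiply, h.2.1, h.2.2.2]
    simp
  have := congrArg det h2
  simpa using this

lemma aux_core {ΩA : Matrix ι ι ℝ} {ΩB : Matrix κ κ ℝ} (hΩA : SympForm ΩA) (hΩB : SympForm ΩB)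
    {S V : Matrix (ι ⊕ κ) (ι ⊕ κ) ℝ} (hS : S.PosDef) (hSV : (V - S).PosSemidef)
    (hTV : (V - fromBlocks ΩA 0 0 ΩB * S⁻¹ * (fromBlocks ΩA 0 0 ΩB)ᵀ).PosSemidef) :
    ∃ G : Matrix (ι ⊕ κ) (ι ⊕ κ) ℝ, IsQCM (fromBlocks ΩA 0 0 ΩB) G ∧ G.det = 1 ∧
      (V - G).PosSemidef ∧ IM G ≤ IM S := by
  have hΩ := hΩA.blocks hΩB
  obtain ⟨G, hG, hsym, hric⟩ := aux_geom hΩ hS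
  have hGT : Gᴴ = G := hG.1
  set T := fromBlocks ΩA 0 0 ΩB * S⁻¹ * (fromBlocks ΩA 0 0 ΩB)ᵀ with hT
  have hdet : G.det = 1 := by
    have h1 := congrArg det hsym
    rw [det_mul, det_mul] at h1
    have h2 := hΩ.det_sq
    have h0 := hG.det_pos
    have h3 : (fromBlocks ΩA 0 0 ΩB).det ≠ 0 := fun h => by simp [h] at h2
    have h4 : (G.det - 1) * (G.det + 1) = 0 := by
      apply mul_right_cancel₀ h3
      linear_combination h1
    rcases mul_eq_zero.mp h4 with h | h <;> linarith
  have hblk : (fromBlocks S G G T).PosSemidef := by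
    let _ := hS.isUnit.invertible
    have : (fromBlocks S G Gᴴ T).PosSemidef := by
      rw [PosDef.fromBlocks₁₁ _ _ hS, hGT, hric, sub_self]
      exact PosSemidef.zero
    rwa [hGT] at this
  refine ⟨G, aux_qcm_of_symp hΩ hG hsym, hdet, ?_, ?_⟩
  · -- `2 (V - G) = (V - S) + (V - T) + (1,-1) block (1,-1)`
    let F : Matrix ((ι ⊕ κ) ⊕ (ι ⊕ κ)) (ι ⊕ κ) ℝ := fromRows 1 (-1)
    have hF : Fᴴ = fromCols 1 (-1) := by
      simp [F, conjTranspose_eq_transpose_of_trivial, transpose_fromRows]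
    have h1 := hblk.conjTranspose_mul_mul_same F
    have h2 : Fᴴ * fromBlocks S G G T * F = S + T - (2 : ℝ) • G := by
      rw [hF, Matrix.mul_assoc, fromBlocks_mul_fromRows, fromCols_mul_fromRows, two_smul]
      simp
      abel
    rw [h2] at h1
    have h3 := ((hSV.add hTV).add h1).smul (a := (1/2 : ℝ)) (by norm_num)
    have h4 : (1/2 : ℝ) • (V - S + (V - T) + (S + T - (2 : ℝ) • G)) = V - G := by
      ext i j
      simp
      ring
    rwa [h4] at h3
  · have hGA : G.toBlocks₁₁.PosDef := hG.submatrix Sum.inl_injective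
    have hGB : G.toBlocks₂₂.PosDef := hG.submatrix Sum.inr_injective
    have hSA : S.toBlocks₁₁.PosDef := hS.submatrix Sum.inl_injective
    have hSB : S.toBlocks₂₂.PosDef := hS.submatrix Sum.inr_injective
    have hT' : T = fromBlocks (ΩA * (S⁻¹).toBlocks₁₁ * ΩAᵀ) (ΩA * (S⁻¹).toBlocks₁₂ * ΩBᵀ)
        (ΩB * (S⁻¹).toBlocks₂₁ * ΩAᵀ) (ΩB * (S⁻¹).toBlocks₂₂ * ΩBᵀ) := by
      rw [hT]
      nth_rewrite 1 [← fromBlocks_toBlocks S⁻¹]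
      simp [fromBlocks_transpose, fromBlocks_multiply]
    have hTA : T.toBlocks₁₁.det = (S⁻¹).toBlocks₁₁.det := by
      rw [hT', toBlocks_fromBlocks₁₁, det_mul, det_mul, det_transpose]
      linear_combination (S⁻¹).toBlocks₁₁.det * hΩA.det_sq
    have hTB : T.toBlocks₂₂.det = (S⁻¹).toBlocks₂₂.det := by
      rw [hT', toBlocks_fromBlocks₂₂, det_mul, det_mul, det_transpose]
      linear_combination (S⁻¹).toBlocks₂₂.det * hΩB.det_sq
    have bA : G.toBlocks₁₁.det * G.toBlocks₁₁.det ≤ S.toBlocks₁₁.det * T.toBlocks₁₁.det := by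
      refine aux_block_det hSA hGA ?_
      convert! hblk.submatrix (Sum.map Sum.inl Sum.inl) using 1
      ext (i | i) (j | j) <;> rfl
    have bB : G.toBlocks₂₂.det * G.toBlocks₂₂.det ≤ S.toBlocks₂₂.det * T.toBlocks₂₂.det := by
      refine aux_block_det hSB hGB ?_
      convert! hblk.submatrix (Sum.map Sum.inr Sum.inr) using 1
      ext (i | i) (j | j) <;> rfl
    have j1 := aux_jacobi₁ hS
    have j2 := aux_jacobi₂ hS
    have sd := hS.det_pos
    have t1 : T.toBlocks₁₁.det = S.toBlocks₂₂.det / S.det := by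
      rw [hTA, ← j1]; field_simp
    have t2 : T.toBlocks₂₂.det = S.toBlocks₁₁.det / S.det := by
      rw [hTB, ← j2]; field_simp
    rw [t1] at bA
    rw [t2] at bB
    have pa := hGA.det_pos
    have pb := hGB.det_pos
    have qa := hSA.det_pos
    have qb := hSB.det_pos
    have hle : G.toBlocks₁₁.det * G.toBlocks₂₂.det / G.det
        ≤ S.toBlocks₁₁.det * S.toBlocks₂₂.det / S.det := by
      rw [hdet, div_one]
      apply le_of_sq_le_sq _ (by positivity)
      calc (G.toBlocks₁₁.det * G.toBlocks₂₂.det) ^ 2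
          = (G.toBlocks₁₁.det * G.toBlocks₁₁.det) * (G.toBlocks₂₂.det * G.toBlocks₂₂.det) := by ring
        _ ≤ (S.toBlocks₁₁.det * (S.toBlocks₂₂.det / S.det)) *
            (S.toBlocks₂₂.det * (S.toBlocks₁₁.det / S.det)) := by gcongr
        _ = _ := by ring
    unfold IM
    have := Real.log_le_log (by rw [hdet]; positivity) hle
    linarith

lemma aux_schur {Ω : Matrix ι ι ℝ} {ΩC : Matrix κ κ ℝ} (hΩ : SympForm Ω) (hΩC : SympForm ΩC)
    {V : Matrix ι ι ℝ} {X : Matrix ι κ ℝ} {Z : Matrix κ κ ℝ}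
    (hW : IsQCM (fromBlocks Ω 0 0 ΩC) (fromBlocks V X Xᵀ Z)) :
    Z.PosDef ∧ (V - X * Z⁻¹ * Xᵀ).PosDef ∧ (X * Z⁻¹ * Xᵀ).PosSemidef ∧
      (V - Ω * (V - X * Z⁻¹ * Xᵀ)⁻¹ * Ωᵀ).PosSemidef := by
  have hWd := hW.posDef (hΩ.blocks hΩC)
  have hR := hW.real_psd (hΩ.blocks hΩC)
  have hZ : Z.PosDef := hWd.submatrix Sum.inr_injective
  have hZu : Z * Z⁻¹ = 1 := mul_nonsing_inv _ hZ.det_pos.ne'.isUnit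
  have hZT : (Z⁻¹)ᵀ = Z⁻¹ := by
    have := hZ.inv.1
    rwa [IsHermitian, conjTranspose_eq_transpose_of_trivial] at this
  let _ := hZ.isUnit.invertible
  have hSp : (V - X * Z⁻¹ * Xᵀ).PosSemidef := by
    have := PosDef.fromBlocks₂₂ V X hZ
    rw [conjTranspose_eq_transpose_of_trivial] at this
    exact this.mp hWd.posSemidef
  have hS : (V - X * Z⁻¹ * Xᵀ).PosDef := hSp.posDef_iff_det_ne_zero.mpr fun h0 => by
    have h := hWd.det_pos
    rw [det_fromBlocks₂₂, invOf_eq_nonsing_inv, h0, mul_zero] at h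
    exact lt_irrefl _ h
  refine ⟨hZ, hS, ?_, ?_⟩
  · have := hZ.inv.posSemidef.mul_mul_conjTranspose_same X
    rwa [conjTranspose_eq_transpose_of_trivial] at this
  set S := V - X * Z⁻¹ * Xᵀ with hSdef
  let E : Matrix (ι ⊕ κ) ι ℝ := fromRows 1 0
  let L : Matrix (ι ⊕ κ) ι ℝ := fromRows 1 (-(Z⁻¹ * Xᵀ))
  have hET : Eᵀ = fromCols 1 0 := by simp [E, transpose_fromRows]
  have hLT : Lᵀ = fromCols 1 (-(X * Z⁻¹)) := by
    simp [L, transpose_fromRows, hZT]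
  have hWL : fromBlocks V X Xᵀ Z * L = fromRows S 0 := by
    simp only [L, fromBlocks_mul_fromRows]
    congr 1
    · rw [hSdef]; simp [sub_eq_add_neg, Matrix.mul_assoc]
    · rw [Matrix.mul_neg, ← Matrix.mul_assoc, hZu]; simp
  have h1 := hR.conjTranspose_mul_mul_same (fromBlocks E 0 0 L)
  have h2 : (fromBlocks E 0 0 L).conjTranspose * fromBlocks (fromBlocks V X Xᵀ Z)
      (fromBlocks Ω 0 0 ΩC) (fromBlocks Ω 0 0 ΩC)ᵀ (fromBlocks V X Xᵀ Z) * fromBlocks E 0 0 L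
      = fromBlocks V Ω Ω.conjTranspose S := by
    rw [conjTranspose_eq_transpose_of_trivial, conjTranspose_eq_transpose_of_trivial,
      fromBlocks_transpose, Matrix.mul_assoc, fromBlocks_multiply, fromBlocks_multiply]
    simp only [Matrix.mul_zero, Matrix.zero_mul, add_zero, zero_add, transpose_zero, hWL, hET, hLT,
      E, L, fromBlocks_transpose, fromBlocks_mul_fromRows, fromCols_mul_fromRows, Matrix.mul_one,
      Matrix.one_mul]
  rw [h2] at h1
  let _ := hS.isUnit.invertible
  rw [PosDef.fromBlocks₂₂ _ _ hS, conjTranspose_eq_transpose_of_trivial] at h1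
  exact h1

lemma aux_ICM {ιA ιB ιC : Type} [Fintype ιA] [DecidableEq ιA]
    [Fintype ιB] [DecidableEq ιB] [Fintype ιC] [DecidableEq ιC]
    (V : Matrix (ιA ⊕ ιB) (ιA ⊕ ιB) ℝ) (X : Matrix (ιA ⊕ ιB) ιC ℝ) (Y : Matrix ιC (ιA ⊕ ιB) ℝ)
    {Z : Matrix ιC ιC ℝ} (hZ : Z.PosDef) :
    ICM (fromBlocks V X Y Z) = IM (V - X * Z⁻¹ * Y) := by
  let _ := hZ.isUnit.invertible
  have e1 : (fromBlocks V X Y Z).submatrix (Sum.elim (Sum.inl ∘ Sum.inl) Sum.inr)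
      (Sum.elim (Sum.inl ∘ Sum.inl) Sum.inr)
      = fromBlocks V.toBlocks₁₁ (X.submatrix Sum.inl id) (Y.submatrix id Sum.inl) Z := by
    ext (i | i) (j | j) <;> rfl
  have e2 : (fromBlocks V X Y Z).submatrix (Sum.elim (Sum.inl ∘ Sum.inr) Sum.inr)
      (Sum.elim (Sum.inl ∘ Sum.inr) Sum.inr)
      = fromBlocks V.toBlocks₂₂ (X.submatrix Sum.inr id) (Y.submatrix id Sum.inr) Z := by
    ext (i | i) (j | j) <;> rfl
  have e3 : (fromBlocks V X Y Z).submatrix Sum.inr Sum.inr = Z := rfl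
  have f1 : V.toBlocks₁₁ - X.submatrix Sum.inl id * Z⁻¹ * Y.submatrix id Sum.inl
      = (V - X * Z⁻¹ * Y).toBlocks₁₁ := by
    ext i j; simp [toBlocks₁₁, mul_apply]
  have f2 : V.toBlocks₂₂ - X.submatrix Sum.inr id * Z⁻¹ * Y.submatrix id Sum.inr
      = (V - X * Z⁻¹ * Y).toBlocks₂₂ := by
    ext i j; simp [toBlocks₂₂, mul_apply]
  unfold ICM IM
  rw [e1, e2, e3, det_fromBlocks₂₂, det_fromBlocks₂₂, det_fromBlocks₂₂, invOf_eq_nonsing_inv,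
    f1, f2]
  have hz := hZ.det_pos.ne'
  congr 2
  generalize (V - X * Z⁻¹ * Y).toBlocks₁₁.det = a
  generalize (V - X * Z⁻¹ * Y).toBlocks₂₂.det = b
  generalize (V - X * Z⁻¹ * Y).det = c
  rw [← mul_div_mul_left (a * b) c (mul_ne_zero hz hz)]
  congr 1 <;> ring

lemma aux_split {Ω W : Matrix (ι ⊕ κ) (ι ⊕ κ) ℝ} (hΩ : SympForm Ω) (hW : IsQCM Ω W) :
    ∃ X Z, W = fromBlocks (W.submatrix Sum.inl Sum.inl) X Xᵀ Z := by
  refine ⟨W.toBlocks₁₂, W.toBlocks₂₂, ?_⟩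
  have h : W.toBlocks₁₂ᵀ = W.toBlocks₂₁ := by
    ext i j
    exact congrFun (congrFun (hW.posDef hΩ).1 (Sum.inr i)) (Sum.inl j)
  rw [h]
  exact (fromBlocks_toBlocks W).symm

/-- the noisy extension -/
lemma aux_ext {Ω : Matrix ι ι ℝ} {ΩC : Matrix κ κ ℝ} (hΩ : SympForm Ω) (hΩC : SympForm ΩC)
    (e : ι ≃ κ) {V G : Matrix ι ι ℝ} (hG : IsQCM Ω G) (hVG : (V - G).PosSemidef) (r : ℝ) :
    ∃ X : Matrix ι κ ℝ, IsQCM (fromBlocks Ω 0 0 ΩC) (fromBlocks V X Xᵀ ((r ^ 2 + 1) • 1)) ∧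
      V - X * ((r ^ 2 + 1) • (1 : Matrix κ κ ℝ))⁻¹ * Xᵀ = G + (r ^ 2 + 1)⁻¹ • (V - G) := by
  obtain ⟨B, hB⟩ := aux_psd_factor hVG
  let X : Matrix ι κ ℝ := Bᵀ.submatrix id e.symm
  have hX : X * Xᵀ = V - G := by
    rw [hB]
    ext i j
    simp only [X, mul_apply, submatrix_apply, transpose_apply, id]
    exact e.symm.sum_comp (fun k => B k i * B k j)
  have hr : (r ^ 2 + 1) ≠ 0 := by positivity
  refine ⟨r • X, ?_, ?_⟩
  · have h1 : IsQCM (fromBlocks Ω 0 0 ΩC) (fromBlocks G 0 0 (1 : Matrix κ κ ℝ)) := by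
      have hone : IsQCM ΩC (1 : Matrix κ κ ℝ) := aux_qcm_of_symp hΩC PosDef.one (by simp)
      have : (fromBlocks (G.map (fun x => (x : ℂ)) + Complex.I • Ω.map (fun x => (x : ℂ))) 0 0
          ((1 : Matrix κ κ ℝ).map (fun x => (x : ℂ)) + Complex.I • ΩC.map (fun x => (x : ℂ)))
          ).PosSemidef := by
        refine PosSemidef.of_dotProduct_mulVec_nonneg ?_ ?_
        · rw [IsHermitian, fromBlocks_conjTranspose, hG.1, hone.1]; simp
        · intro z
          have a := hG.dotProduct_mulVec_nonneg (z ∘ Sum.inl)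
          have b := hone.dotProduct_mulVec_nonneg (z ∘ Sum.inr)
          have := add_nonneg a b
          rw [fromBlocks_mulVec]
          simp only [zero_mulVec, add_zero, zero_add]
          simpa [dotProduct] using this
      unfold IsQCM
      convert! this using 1
      ext (i | i) (j | j) <;> simp [one_apply, apply_ite]
    have h2 : (fromRows X (r • (1 : Matrix κ κ ℝ)) * (fromRows X (r • (1 : Matrix κ κ ℝ)))ᴴ).PosSemidef :=
      posSemidef_self_mul_conjTranspose _
    have h3 := h1.add h2
    convert! h3 using 1
    rw [conjTranspose_eq_transpose_of_trivial, transpose_fromRows, fromRows_mul_fromCols,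
      fromBlocks_add, hX]
    congr 1
    · abel
    · simp
    · simp
    · simp [smul_smul, add_smul, sq, add_comm]
  · have : ((r ^ 2 + 1) • (1 : Matrix κ κ ℝ))⁻¹ = (r ^ 2 + 1)⁻¹ • 1 := by
      apply inv_eq_right_inv
      simp [smul_smul, hr]
    rw [this]
    simp only [transpose_smul, Matrix.smul_mul, Matrix.mul_smul, Matrix.mul_one, smul_smul, hX]
    ext i j
    simp
    field_simp
    ring

lemma aux_IM_tendsto {G P : Matrix (ι ⊕ κ) (ι ⊕ κ) ℝ} (hG : G.PosDef) :
    Filter.Tendsto (fun r : ℝ => IM (G + (r ^ 2 + 1)⁻¹ • P)) Filter.atTop (nhds (IM G)) := by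
  have h0 : Filter.Tendsto (fun r : ℝ => (r ^ 2 + 1)⁻¹) Filter.atTop (nhds 0) := by
    apply Filter.Tendsto.inv_tendsto_atTop
    exact Filter.tendsto_atTop_add_const_right _ _ (Filter.tendsto_pow_atTop two_ne_zero)
  have hA : G.toBlocks₁₁.PosDef := hG.submatrix Sum.inl_injective
  have hB : G.toBlocks₂₂.PosDef := hG.submatrix Sum.inr_injective
  have hc : ContinuousAt (fun s : ℝ => IM (G + s • P)) 0 := by
    unfold IM
    have c0 : Continuous fun s : ℝ => G + s • P := by fun_prop
    have c1 : Continuous fun s : ℝ => (G + s • P).toBlocks₁₁.det :=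
      (c0.matrix_submatrix Sum.inl Sum.inl).matrix_det
    have c2 : Continuous fun s : ℝ => (G + s • P).toBlocks₂₂.det :=
      (c0.matrix_submatrix Sum.inr Sum.inr).matrix_det
    have c3 : Continuous fun s : ℝ => (G + s • P).det := c0.matrix_det
    have g := hG.det_pos
    have a := hA.det_pos
    have b := hB.det_pos
    refine ContinuousAt.mul continuousAt_const (ContinuousAt.log ?_ ?_)
    · exact (c1.mul c2).continuousAt.div c3.continuousAt (by simpa using g.ne')
    · simp only [zero_smul, add_zero]
      positivity
  have := hc.tendsto.comp h0
  simpa [Function.comp_def] using this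

end Helpers

/-- **Gaussian Rényi-2 squashed entanglement equals Gaussian Rényi-2 entanglement of
formation.**  For every bipartite QCM `V_AB`, the infimum of `½ I_M(A:B|C)_W` over QCM
extensions `W` of `V_AB` (with `C` carrying arbitrarily many modes) and the infimum of
`½ I_M(A:B)_γ` over pure QCMs `γ ≤ V_AB` are infima of nonempty sets of nonnegative
reals, and they coincide. -/
theorem gaussian_squashed_eq_eof (nA nB : ℕ)
    (V : Matrix ((Fin 2 × Fin nA) ⊕ (Fin 2 × Fin nB))
        ((Fin 2 × Fin nA) ⊕ (Fin 2 × Fin nB)) ℝ)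
    (hV : IsQCM (fromBlocks (Omega nA) 0 0 (Omega nB)) V) :
    {x : ℝ | ∃ γ : Matrix ((Fin 2 × Fin nA) ⊕ (Fin 2 × Fin nB))
          ((Fin 2 × Fin nA) ⊕ (Fin 2 × Fin nB)) ℝ,
        IsQCM (fromBlocks (Omega nA) 0 0 (Omega nB)) γ ∧ γ.det = 1 ∧
          (V - γ).PosSemidef ∧ x = (1 / 2 : ℝ) * IM γ}.Nonempty
    ∧ {x : ℝ | ∃ (m : ℕ)
          (W : Matrix (((Fin 2 × Fin nA) ⊕ (Fin 2 × Fin nB)) ⊕ (Fin 2 × Fin m))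
            (((Fin 2 × Fin nA) ⊕ (Fin 2 × Fin nB)) ⊕ (Fin 2 × Fin m)) ℝ),
        IsQCM (fromBlocks (fromBlocks (Omega nA) 0 0 (Omega nB)) 0 0 (Omega m)) W ∧
          W.submatrix Sum.inl Sum.inl = V ∧ x = (1 / 2 : ℝ) * ICM W}.Nonempty
    ∧ (∀ x ∈ {x : ℝ | ∃ γ : Matrix ((Fin 2 × Fin nA) ⊕ (Fin 2 × Fin nB))
          ((Fin 2 × Fin nA) ⊕ (Fin 2 × Fin nB)) ℝ,
        IsQCM (fromBlocks (Omega nA) 0 0 (Omega nB)) γ ∧ γ.det = 1 ∧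
          (V - γ).PosSemidef ∧ x = (1 / 2 : ℝ) * IM γ}, 0 ≤ x)
    ∧ (∀ x ∈ {x : ℝ | ∃ (m : ℕ)
          (W : Matrix (((Fin 2 × Fin nA) ⊕ (Fin 2 × Fin nB)) ⊕ (Fin 2 × Fin m))
            (((Fin 2 × Fin nA) ⊕ (Fin 2 × Fin nB)) ⊕ (Fin 2 × Fin m)) ℝ),
        IsQCM (fromBlocks (fromBlocks (Omega nA) 0 0 (Omega nB)) 0 0 (Omega m)) W ∧
          W.submatrix Sum.inl Sum.inl = V ∧ x = (1 / 2 : ℝ) * ICM W}, 0 ≤ x)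
    ∧ sInf {x : ℝ | ∃ (m : ℕ)
          (W : Matrix (((Fin 2 × Fin nA) ⊕ (Fin 2 × Fin nB)) ⊕ (Fin 2 × Fin m))
            (((Fin 2 × Fin nA) ⊕ (Fin 2 × Fin nB)) ⊕ (Fin 2 × Fin m)) ℝ),
        IsQCM (fromBlocks (fromBlocks (Omega nA) 0 0 (Omega nB)) 0 0 (Omega m)) W ∧
          W.submatrix Sum.inl Sum.inl = V ∧ x = (1 / 2 : ℝ) * ICM W}
      = sInf {x : ℝ | ∃ γ : Matrix ((Fin 2 × Fin nA) ⊕ (Fin 2 × Fin nB))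
          ((Fin 2 × Fin nA) ⊕ (Fin 2 × Fin nB)) ℝ,
        IsQCM (fromBlocks (Omega nA) 0 0 (Omega nB)) γ ∧ γ.det = 1 ∧
          (V - γ).PosSemidef ∧ x = (1 / 2 : ℝ) * IM γ} := by
  have hA := aux_omega nA
  have hB := aux_omega nB
  have hΩ := hA.blocks hB
  have hVd := hV.posDef hΩ
  have key : ∀ (m : ℕ) (W : Matrix (((Fin 2 × Fin nA) ⊕ (Fin 2 × Fin nB)) ⊕ (Fin 2 × Fin m))
      (((Fin 2 × Fin nA) ⊕ (Fin 2 × Fin nB)) ⊕ (Fin 2 × Fin m)) ℝ),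
      IsQCM (fromBlocks (fromBlocks (Omega nA) 0 0 (Omega nB)) 0 0 (Omega m)) W →
      W.submatrix Sum.inl Sum.inl = V →
      0 ≤ ICM W ∧ ∃ γ, IsQCM (fromBlocks (Omega nA) 0 0 (Omega nB)) γ ∧ γ.det = 1 ∧
        (V - γ).PosSemidef ∧ IM γ ≤ ICM W := by
    intro m W hW hWV
    obtain ⟨X, Z, h⟩ := aux_split (hΩ.blocks (aux_omega m)) hW
    rw [hWV] at h
    rw [h] at hW
    obtain ⟨hZ, hS, hX, hT⟩ := aux_schur hΩ (aux_omega m) hW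
    rw [h, aux_ICM _ _ _ hZ]
    exact ⟨aux_IM_nonneg hS, aux_core hA hB hS (by rwa [sub_sub_cancel]) hT⟩
  have ext : ∀ γ, IsQCM (fromBlocks (Omega nA) 0 0 (Omega nB)) γ → (V - γ).PosSemidef → ∀ r : ℝ,
      ∃ W : Matrix (((Fin 2 × Fin nA) ⊕ (Fin 2 × Fin nB)) ⊕ (Fin 2 × Fin (nA + nB)))
      (((Fin 2 × Fin nA) ⊕ (Fin 2 × Fin nB)) ⊕ (Fin 2 × Fin (nA + nB))) ℝ,
      IsQCM (fromBlocks (fromBlocks (Omega nA) 0 0 (Omega nB)) 0 0 (Omega (nA + nB))) W ∧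
      W.submatrix Sum.inl Sum.inl = V ∧ ICM W = IM (γ + (r ^ 2 + 1)⁻¹ • (V - γ)) := by
    intro γ hγ hVγ r
    have e : ((Fin 2 × Fin nA) ⊕ (Fin 2 × Fin nB)) ≃ Fin 2 × Fin (nA + nB) :=
      Fintype.equivOfCardEq (by simp; ring)
    obtain ⟨X, h1, h2⟩ := aux_ext hΩ (aux_omega (nA + nB)) e hγ hVγ r
    refine ⟨_, h1, rfl, ?_⟩
    rw [aux_ICM, h2]
    exact (h1.posDef (hΩ.blocks (aux_omega _))).submatrix Sum.inr_injective
  have hne : ∃ γ, IsQCM (fromBlocks (Omega nA) 0 0 (Omega nB)) γ ∧ γ.det = 1 ∧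
        (V - γ).PosSemidef := by
    obtain ⟨γ, h1, h2, h3, -⟩ := aux_core hA hB hVd (V := V) (by simpa using PosSemidef.zero) (by
      have hR := hV.real_psd hΩ
      let _ := hVd.isUnit.invertible
      rw [← conjTranspose_eq_transpose_of_trivial, PosDef.fromBlocks₂₂ _ _ hVd] at hR
      exact hR)
    exact ⟨γ, h1, h2, h3⟩
  obtain ⟨γ₀, hγ₀, hd₀, hle₀⟩ := hne
  have nE : ∀ x ∈ {x : ℝ | ∃ γ : Matrix ((Fin 2 × Fin nA) ⊕ (Fin 2 × Fin nB))
          ((Fin 2 × Fin nA) ⊕ (Fin 2 × Fin nB)) ℝ,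
        IsQCM (fromBlocks (Omega nA) 0 0 (Omega nB)) γ ∧ γ.det = 1 ∧
          (V - γ).PosSemidef ∧ x = (1 / 2 : ℝ) * IM γ}, 0 ≤ x := by
    rintro x ⟨γ, hγ, -, -, rfl⟩
    have := aux_IM_nonneg (hγ.posDef hΩ)
    positivity
  have nS : ∀ x ∈ {x : ℝ | ∃ (m : ℕ)
          (W : Matrix (((Fin 2 × Fin nA) ⊕ (Fin 2 × Fin nB)) ⊕ (Fin 2 × Fin m))
            (((Fin 2 × Fin nA) ⊕ (Fin 2 × Fin nB)) ⊕ (Fin 2 × Fin m)) ℝ),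
        IsQCM (fromBlocks (fromBlocks (Omega nA) 0 0 (Omega nB)) 0 0 (Omega m)) W ∧
          W.submatrix Sum.inl Sum.inl = V ∧ x = (1 / 2 : ℝ) * ICM W}, 0 ≤ x := by
    rintro x ⟨m, W, hW, hWV, rfl⟩
    have := (key m W hW hWV).1
    positivity
  refine ⟨⟨_, γ₀, hγ₀, hd₀, hle₀, rfl⟩, ?_, nE, nS, ?_⟩
  · obtain ⟨W, h1, h2, -⟩ := ext γ₀ hγ₀ hle₀ 0
    exact ⟨_, _, W, h1, h2, rfl⟩
  apply le_antisymm
  · refine le_csInf ⟨_, γ₀, hγ₀, hd₀, hle₀, rfl⟩ ?_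
    rintro x ⟨γ, hγ, -, hle, rfl⟩
    refine ge_of_tendsto ((aux_IM_tendsto (P := V - γ) (hγ.posDef hΩ)).const_mul (1 / 2 : ℝ))
      (Filter.Eventually.of_forall fun r => ?_)
    obtain ⟨W, h1, h2, h3⟩ := ext γ hγ hle r
    exact csInf_le ⟨0, nS⟩ ⟨_, W, h1, h2, by rw [h3]⟩
  · obtain ⟨W, h1, h2, -⟩ := ext γ₀ hγ₀ hle₀ 0
    refine le_csInf ⟨_, _, W, h1, h2, rfl⟩ ?_
    rintro x ⟨m, W, hW, hWV, rfl⟩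
    obtain ⟨-, γ, g1, g2, g3, g4⟩ := key m W hW hWV
    exact (csInf_le ⟨0, nE⟩ ⟨γ, g1, g2, g3, rfl⟩).trans (by linarith)
end

section
/- Let σ_0, σ_1 be density matrices on ℂ^d and set H := H(X|B) = ln 2 + ½H(σ_0) + ½H(σ_1) − H((σ_0+σ_1)/2), and let G := H(X_1+X_2|B_1B_2) = ln 2 + ½H(½(σ_0⊗σ_0 + σ_1⊗σ_1)) + ½H(½(σ_0⊗σ_1 + σ_1⊗σ_0)) − H(((σ_0+σ_1)/2) ⊗ ((σ_0+σ_1)/2)) be the conditional entropy of the sum of two i.i.d. uniform binary inputs given the two quantum outputs. Then (with natural logarithms): if 0 < H ≤ ½ ln 2, then G ≥ H + 0.083 · H/(1 − ln H); and if ½ ln 2 ≤ H < ln 2, then G ≥ H + 0.083 · (ln 2 − H)/(1 − ln(ln 2 − H)). -/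
open Matrix ComplexOrder Kronecker

/-- Von Neumann entropy `H(ρ) = Σ_i (−λ_i ln λ_i)` of a Hermitian matrix, via its
eigenvalues (junk value `0` on non-Hermitian matrices). -/
noncomputable def vN {ι : Type} [Fintype ι] [DecidableEq ι] (ρ : Matrix ι ι ℂ) : ℝ :=
  if h : ρ.IsHermitian then ∑ i, Real.negMulLog (h.eigenvalues i) else 0

/-- Trace of a function of a matrix, through the roots of the characteristic polynomial. -/
noncomputable def trf {ι : Type} [Fintype ι] [DecidableEq ι] (f : ℝ → ℝ) (X : Matrix ι ι ℂ) : ℝ :=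
  (X.charpoly.roots.map (fun z => f z.re)).sum

section basics
variable {ι : Type} [Fintype ι] [DecidableEq ι]

lemma trf_eq_eig (f : ℝ → ℝ) {X : Matrix ι ι ℂ} (h : X.IsHermitian) :
    trf f X = ∑ i, f (h.eigenvalues i) := by
  unfold trf
  rw [h.roots_charpoly_eq_eigenvalues, Multiset.map_map]
  rfl

lemma vN_eq {X : Matrix ι ι ℂ} (h : X.IsHermitian) : vN X = trf Real.negMulLog X := by
  rw [trf_eq_eig _ h, vN, dif_pos h]

lemma trf_conj (f : ℝ → ℝ) (U V : Matrix ι ι ℂ) (hU : V * U = 1) (d : ι → ℝ) :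
    trf f (U * diagonal (fun i => (d i : ℂ)) * V) = ∑ i, f (d i) := by
  unfold trf
  rw [Matrix.charpoly_mul_comm, ← mul_assoc, hU, one_mul, Matrix.charpoly_diagonal,
    Polynomial.roots_prod _ _ (by simp [Finset.prod_ne_zero_iff, Polynomial.X_sub_C_ne_zero])]
  simp

/-- Spectral decomposition. -/
lemma spec_s18 {X : Matrix ι ι ℂ} (h : X.IsHermitian) :
    ∃ (U : Matrix ι ι ℂ) (d : ι → ℝ), Uᴴ * U = 1 ∧ U * Uᴴ = 1 ∧
      X = U * diagonal (fun i => (d i : ℂ)) * Uᴴ := by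
  refine ⟨h.eigenvectorUnitary, h.eigenvalues, ?_, ?_, ?_⟩
  · exact Unitary.coe_star_mul_self h.eigenvectorUnitary
  · exact Unitary.coe_mul_star_self h.eigenvectorUnitary
  · conv_lhs => rw [h.spectral_theorem]
    rw [Unitary.conjStarAlgAut_apply]
    rfl

lemma conj_shift (U : Matrix ι ι ℂ) (hU : U * Uᴴ = 1) (d : ι → ℝ) (a b : ℝ) :
    a • (U * diagonal (fun i => (d i : ℂ)) * Uᴴ) + b • (1 : Matrix ι ι ℂ) =
    U * diagonal (fun i => ((a * d i + b : ℝ) : ℂ)) * Uᴴ := by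
  have : diagonal (fun i => ((a * d i + b : ℝ) : ℂ)) =
      a • diagonal (fun i => (d i : ℂ)) + b • (1 : Matrix ι ι ℂ) := by
    ext i j
    by_cases hij : i = j
    · subst hij; simp
    · simp [hij]
  rw [this, mul_add, add_mul]
  simp [hU]

lemma trf_affine (f : ℝ → ℝ) {X : Matrix ι ι ℂ} (h : X.IsHermitian) (a b : ℝ) :
    trf f (a • X + b • (1 : Matrix ι ι ℂ)) = trf (fun x => f (a * x + b)) X := by
  obtain ⟨U, d, h1, h2, rfl⟩ := spec_s18 h
  rw [conj_shift U h2, trf_conj _ _ _ h1, trf_conj _ _ _ h1]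

lemma trf_mul_add (a b : ℝ) (f g : ℝ → ℝ) (X : Matrix ι ι ℂ) :
    trf (fun x => a * f x + b * g x) X = a * trf f X + b * trf g X := by
  unfold trf
  rw [Multiset.sum_map_add, Multiset.sum_map_mul_left, Multiset.sum_map_mul_left]

lemma trf_id {X : Matrix ι ι ℂ} (h : X.IsHermitian) : trf (fun x => x) X = X.trace.re := by
  rw [trf_eq_eig _ h, h.trace_eq_sum_eigenvalues]; simp

lemma trf_one {X : Matrix ι ι ℂ} (h : X.IsHermitian) : trf (fun _ => 1) X = Fintype.card ι := by
  rw [trf_eq_eig _ h]; simp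

lemma trf_congr_pos {f g : ℝ → ℝ} {X : Matrix ι ι ℂ} (h : X.PosSemidef)
    (hfg : ∀ x, 0 ≤ x → f x = g x) : trf f X = trf g X := by
  rw [trf_eq_eig _ h.1, trf_eq_eig _ h.1]
  exact Finset.sum_congr rfl fun i _ => hfg _ (h.eigenvalues_nonneg i)

lemma trf_log_det {X : Matrix ι ι ℂ} (h : X.PosDef) : trf Real.log X = Real.log (X.det.re) := by
  rw [trf_eq_eig _ h.1, h.1.det_eq_prod_eigenvalues]
  have : (∏ i, ((h.1.eigenvalues i : ℝ) : ℂ)) = ((∏ i, h.1.eigenvalues i : ℝ) : ℂ) := by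
    push_cast; rfl
  erw [this]
  rw [Complex.ofReal_re, Real.log_prod]
  intro i _
  exact (h.eigenvalues_pos i).ne.symm

/-- positive part trace -/
noncomputable def tp (X : Matrix ι ι ℂ) : ℝ := trf (fun x => max x 0) X

lemma diag_nonneg_re {P : Matrix ι ι ℂ} (h : P.PosSemidef) (U : Matrix ι ι ℂ) (i : ι) :
    0 ≤ ((Uᴴ * P * U) i i).re := by
  have := (h.conjTranspose_mul_mul_same U).diag_nonneg (i := i)
  exact (Complex.le_def.1 this).1

lemma tr_conj (P U : Matrix ι ι ℂ) (hU : U * Uᴴ = 1) :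
    P.trace.re = ∑ i, ((Uᴴ * P * U) i i).re := by
  have : (Uᴴ * P * U).trace = P.trace := by
    rw [Matrix.trace_mul_comm, ← mul_assoc, hU, one_mul]
  rw [← this, Matrix.trace]; simp

lemma diag_conj (U : Matrix ι ι ℂ) (hU : Uᴴ * U = 1) (d : ι → ℝ) (i : ι) :
    ((Uᴴ * (U * diagonal (fun i => (d i : ℂ)) * Uᴴ) * U) i i).re = d i := by
  have : Uᴴ * (U * diagonal (fun i => (d i : ℂ)) * Uᴴ) * U = diagonal (fun i => (d i : ℂ)) := by
    calc _ = (Uᴴ * U) * diagonal (fun i => (d i : ℂ)) * (Uᴴ * U) := by simp only [mul_assoc]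
      _ = _ := by rw [hU]; simp
  rw [this]; simp

lemma tp_le {X P : Matrix ι ι ℂ} (hX : X.IsHermitian) (hP : P.PosSemidef)
    (h : (P - X).PosSemidef) : tp X ≤ P.trace.re := by
  obtain ⟨U, d, h1, h2, rfl⟩ := spec_s18 hX
  rw [tp, trf_conj _ _ _ h1, tr_conj P U h2]
  refine Finset.sum_le_sum fun i _ => max_le ?_ (diag_nonneg_re hP U i)
  have := diag_nonneg_re h U i
  rw [mul_sub, sub_mul, Matrix.sub_apply, Complex.sub_re, diag_conj U h1] at this
  linarith

lemma tp_abs_le {X P Q R : Matrix ι ι ℂ} (hX : X.IsHermitian) (hP : P.PosSemidef)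
    (hQ : Q.PosSemidef)
    (h : (P + R - X).PosSemidef) (h' : (Q + R - (-X)).PosSemidef) :
    tp X + tp (-X) ≤ P.trace.re + Q.trace.re + R.trace.re := by
  have hneg : tp (-X) = trf (fun x => max (-x) 0) X := by
    have := trf_affine (fun x => max x 0) hX (-1) 0
    simpa [tp] using this
  obtain ⟨U, d, h1, h2, rfl⟩ := spec_s18 hX
  rw [hneg, tp, trf_conj _ _ _ h1, trf_conj _ _ _ h1, tr_conj P U h2, tr_conj Q U h2, tr_conj R U h2,
    ← Finset.sum_add_distrib, ← Finset.sum_add_distrib, ← Finset.sum_add_distrib]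
  refine Finset.sum_le_sum fun i _ => ?_
  have a1 := diag_nonneg_re hP U i
  have a2 := diag_nonneg_re hQ U i
  have a3 := diag_nonneg_re h U i
  have a4 := diag_nonneg_re h' U i
  rw [mul_sub, sub_mul, Matrix.sub_apply, Complex.sub_re, diag_conj U h1, mul_add, add_mul,
    Matrix.add_apply, Complex.add_re] at a3
  rw [sub_neg_eq_add, mul_add, add_mul, Matrix.add_apply, Complex.add_re, diag_conj U h1, mul_add,
    add_mul, Matrix.add_apply, Complex.add_re] at a4
  rcases le_total 0 (d i) with hd | hd
  · rw [max_eq_left hd, max_eq_right (by linarith)]; linarith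
  · rw [max_eq_right hd, max_eq_left (by linarith)]; linarith

lemma exists_pos_part {X : Matrix ι ι ℂ} (hX : X.IsHermitian) :
    ∃ P : Matrix ι ι ℂ, P.PosSemidef ∧ (P - X).PosSemidef ∧ P.trace.re = tp X ∧
      (P - X).trace.re = tp (-X) := by
  have hneg : tp (-X) = trf (fun x => max (-x) 0) X := by
    have := trf_affine (fun x => max x 0) hX (-1) 0
    simpa [tp] using this
  rw [hneg]
  obtain ⟨U, d, h1, h2, rfl⟩ := spec_s18 hX
  have key : ∀ g : ι → ℝ, (∀ i, 0 ≤ g i) →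
      (U * diagonal (fun i => (g i : ℂ)) * Uᴴ).PosSemidef := by
    intro g hg
    apply PosSemidef.mul_mul_conjTranspose_same
    apply PosSemidef.diagonal
    intro i
    simpa using hg i
  have tr : ∀ g : ι → ℝ, (U * diagonal (fun i => (g i : ℂ)) * Uᴴ).trace.re = ∑ i, g i := by
    intro g
    rw [tr_conj _ U h2]
    exact Finset.sum_congr rfl fun i _ => diag_conj U h1 g i
  have hsub : U * diagonal (fun i => ((max (d i) 0 : ℝ) : ℂ)) * Uᴴ
      - U * diagonal (fun i => (d i : ℂ)) * Uᴴ
      = U * diagonal (fun i => ((max (-d i) 0 : ℝ) : ℂ)) * Uᴴ := by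
    rw [← sub_mul, ← mul_sub, diagonal_sub]
    congr 3
    ext i
    rw [← Complex.ofReal_sub]
    congr 1
    rcases le_total 0 (d i) with hd | hd
    · rw [max_eq_left hd, max_eq_right (by linarith)]; linarith
    · rw [max_eq_right hd, max_eq_left (by linarith)]; linarith
  refine ⟨U * diagonal (fun i => ((max (d i) 0 : ℝ) : ℂ)) * Uᴴ, key _ fun i => le_max_right _ _,
    ?_, ?_, ?_⟩
  · rw [hsub]; exact key _ fun i => le_max_right _ _
  · rw [tr, tp, trf_conj _ _ _ h1]
  · rw [hsub, tr, trf_conj _ _ _ h1]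

lemma tp_nonneg (X : Matrix ι ι ℂ) : 0 ≤ tp X := by
  unfold tp trf
  apply Multiset.sum_nonneg
  intro x hx
  obtain ⟨z, _, rfl⟩ := Multiset.mem_map.1 hx
  exact le_max_right _ _

end basics

section ee
variable {ι : Type} [Fintype ι] [DecidableEq ι]

noncomputable def eE (A D : Matrix ι ι ℂ) (s : ℝ) : ℝ := tp (D - s • A) + tp (-D - s • A)

lemma herm_smul {A : Matrix ι ι ℂ} (h : A.IsHermitian) (s : ℝ) : (s • A).IsHermitian := by
  unfold Matrix.IsHermitian
  rw [conjTranspose_smul, h.eq]; simp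

lemma psd_smul {A : Matrix ι ι ℂ} (h : A.PosSemidef) {s : ℝ} (hs : 0 ≤ s) :
    (s • A).PosSemidef := h.smul hs

lemma tr_smul (A : Matrix ι ι ℂ) (s : ℝ) : (s • A).trace.re = s * A.trace.re := by
  rw [trace_smul]; simp

lemma tp_mono {X Y : Matrix ι ι ℂ} (hX : X.IsHermitian) (hY : Y.IsHermitian)
    (h : (Y - X).PosSemidef) : tp X ≤ tp Y := by
  obtain ⟨P, h1, h2, h3, -⟩ := exists_pos_part hY
  rw [← h3]
  refine tp_le hX h1 ?_
  have : P - X = (P - Y) + (Y - X) := by abel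
  rw [this]; exact h2.add h

lemma eE_nonneg (A D : Matrix ι ι ℂ) (s : ℝ) : 0 ≤ eE A D s :=
  add_nonneg (tp_nonneg _) (tp_nonneg _)

lemma eE_antitone {A D : Matrix ι ι ℂ} (hA : A.PosSemidef) (hD : D.IsHermitian) :
    Antitone (eE A D) := by
  intro s t hst
  have h := psd_smul hA (sub_nonneg.2 hst)
  refine add_le_add (tp_mono (hD.sub (herm_smul hA.1 _)) (hD.sub (herm_smul hA.1 _)) ?_)
    (tp_mono (hD.neg.sub (herm_smul hA.1 _)) (hD.neg.sub (herm_smul hA.1 _)) ?_)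
  · convert h using 1
    rw [sub_smul]; abel
  · convert h using 1
    rw [sub_smul]; abel

lemma eE_lower {A D : Matrix ι ι ℂ} (hA : A.PosSemidef) (hD : D.IsHermitian) (s : ℝ) :
    eE A D 0 ≤ eE A D s + s * A.trace.re := by
  obtain ⟨P, h1, h2, h3, -⟩ := exists_pos_part (hD.sub (herm_smul hA.1 s))
  obtain ⟨Q, k1, k2, k3, -⟩ := exists_pos_part (hD.neg.sub (herm_smul hA.1 s))
  have := tp_abs_le (R := s • A) hD h1 k1 (by convert h2 using 1; abel) (by convert k2 using 1; abel)
  rw [h3, k3, tr_smul] at this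
  simpa [eE] using this

lemma eE_upper {A D : Matrix ι ι ℂ} (hA : A.PosSemidef) (hD : D.IsHermitian)
    (h₁ : (A - D).PosSemidef) (h₂ : (A + D).PosSemidef) {s : ℝ} (hs : 0 ≤ s) (hs1 : s ≤ 1) :
    eE A D s ≤ (1 - s) * eE A D 0 := by
  obtain ⟨P, p1, p2, p3, -⟩ := exists_pos_part hD
  obtain ⟨Q, q1, q2, q3, -⟩ := exists_pos_part hD.neg
  have a1 : tp (D - s • A) ≤ (1 - s) * tp D := by
    rw [← p3, ← tr_smul]
    refine tp_le (hD.sub (herm_smul hA.1 s)) (psd_smul p1 (by linarith)) ?_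
    convert (psd_smul p2 (sub_nonneg.2 hs1)).add (psd_smul h₁ hs) using 1
    simp only [smul_sub, sub_smul, one_smul]; abel
  have a2 : tp (-D - s • A) ≤ (1 - s) * tp (-D) := by
    rw [← q3, ← tr_smul]
    refine tp_le (hD.neg.sub (herm_smul hA.1 s)) (psd_smul q1 (by linarith)) ?_
    convert (psd_smul q2 (sub_nonneg.2 hs1)).add (psd_smul h₂ hs) using 1
    simp only [smul_sub, sub_smul, one_smul, smul_add, smul_neg]; abel
  have : eE A D 0 = tp D + tp (-D) := by simp [eE]
  rw [this]
  unfold eE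
  linarith

lemma herm_kron {κ : Type} [Fintype κ] {A : Matrix ι ι ℂ} {B : Matrix κ κ ℂ} (hA : A.IsHermitian)
    (hB : B.IsHermitian) : (A ⊗ₖ B).IsHermitian := by
  unfold Matrix.IsHermitian
  rw [conjTranspose_kronecker, hA.eq, hB.eq]

lemma eE0_tensor {A D : Matrix ι ι ℂ} (hD : D.IsHermitian) :
    eE (A ⊗ₖ A) (D ⊗ₖ D) 0 ≤ (eE A D 0) ^ 2 := by
  obtain ⟨P, p1, p2, p3, p4⟩ := exists_pos_part hD
  set N := P - D with hN
  have hDD : D = P - N := by rw [hN]; abel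
  have tr : ∀ X Y : Matrix ι ι ℂ, X.PosSemidef → Y.PosSemidef →
      ((X ⊗ₖ Y).trace).re = X.trace.re * Y.trace.re := by
    intro X Y hX hY
    have h1 : X.trace.im = 0 := by
      have := (Complex.le_def.1 hX.trace_nonneg).2; simpa using this.symm
    rw [trace_kronecker, Complex.mul_re, h1]; simp
  have e1 : D ⊗ₖ D = (P ⊗ₖ P + N ⊗ₖ N) - (P ⊗ₖ N + N ⊗ₖ P) := by
    rw [hDD]; ext ⟨i, j⟩ ⟨k, l⟩; simp [kroneckerMap_apply]; ring
  have a1 : tp (D ⊗ₖ D) ≤ tp D * tp D + tp (-D) * tp (-D) := by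
    have := tp_le (P := P ⊗ₖ P + N ⊗ₖ N) (herm_kron hD hD)
      ((p1.kronecker p1).add (p2.kronecker p2)) (by
        rw [e1, sub_sub_cancel]; exact (p1.kronecker p2).add (p2.kronecker p1))
    rwa [trace_add, Complex.add_re, tr _ _ p1 p1, tr _ _ p2 p2, p3, p4] at this
  have a2 : tp (-(D ⊗ₖ D)) ≤ tp D * tp (-D) + tp (-D) * tp D := by
    have := tp_le (P := P ⊗ₖ N + N ⊗ₖ P) (herm_kron hD hD).neg
      ((p1.kronecker p2).add (p2.kronecker p1)) (by
        rw [e1]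
        rw [sub_neg_eq_add, add_sub_cancel]
        exact (p1.kronecker p1).add (p2.kronecker p2))
    rwa [trace_add, Complex.add_re, tr _ _ p1 p2, tr _ _ p2 p1, p3, p4] at this
  have h1 : eE A D 0 = tp D + tp (-D) := by simp [eE]
  have h2 : eE (A ⊗ₖ A) (D ⊗ₖ D) 0 = tp (D ⊗ₖ D) + tp (-(D ⊗ₖ D)) := by simp [eE]
  rw [h1, h2]
  nlinarith

lemma eE_tensor {A D : Matrix ι ι ℂ} (hA : A.PosSemidef) (hD : D.IsHermitian)
    (h₁ : (A - D).PosSemidef) (h₂ : (A + D).PosSemidef)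
    (t₁ : (A - D).trace = 1) (t₂ : (A + D).trace = 1) (s : ℝ) :
    eE (A ⊗ₖ A) (D ⊗ₖ D) s ≤ eE A D s := by
  obtain ⟨P, p1, p2, p3, -⟩ := exists_pos_part (hD.sub (herm_smul hA.1 s))
  obtain ⟨Q, q1, q2, q3, -⟩ := exists_pos_part (hD.neg.sub (herm_smul hA.1 s))
  have half : (0 : ℝ) ≤ 1 / 2 := by norm_num
  have hAA := herm_smul (herm_kron hA.1 hA.1) s
  have hDD := herm_kron hD hD
  have a1 : tp (D ⊗ₖ D - s • (A ⊗ₖ A)) ≤ (P.trace.re + Q.trace.re) / 2 := by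
    have := tp_le (P := (1 / 2 : ℝ) • (P ⊗ₖ (A + D)) + (1 / 2 : ℝ) • (Q ⊗ₖ (A - D)))
      (hDD.sub hAA)
      ((psd_smul (p1.kronecker h₂) half).add (psd_smul (q1.kronecker h₁) half)) (by
        convert (psd_smul (p2.kronecker h₂) half).add (psd_smul (q2.kronecker h₁) half) using 1
        ext ⟨i, j⟩ ⟨k, l⟩; simp [kroneckerMap_apply]; ring)
    rw [trace_add, Complex.add_re, tr_smul, tr_smul, trace_kronecker, trace_kronecker, t₁, t₂] at this
    simp only [mul_one] at this
    linarith
  have a2 : tp (-(D ⊗ₖ D) - s • (A ⊗ₖ A)) ≤ (P.trace.re + Q.trace.re) / 2 := by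
    have := tp_le (P := (1 / 2 : ℝ) • (P ⊗ₖ (A - D)) + (1 / 2 : ℝ) • (Q ⊗ₖ (A + D)))
      (hDD.neg.sub hAA)
      ((psd_smul (p1.kronecker h₁) half).add (psd_smul (q1.kronecker h₂) half)) (by
        convert (psd_smul (p2.kronecker h₁) half).add (psd_smul (q2.kronecker h₂) half) using 1
        ext ⟨i, j⟩ ⟨k, l⟩; simp [kroneckerMap_apply]; ring)
    rw [trace_add, Complex.add_re, tr_smul, tr_smul, trace_kronecker, trace_kronecker, t₁, t₂] at this
    simp only [mul_one] at this
    linarith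
  rw [p3, q3] at a1 a2
  unfold eE
  linarith

end ee

section inertia
variable {ι : Type} [Fintype ι] [DecidableEq ι]

/-- number of positive eigenvalues -/
noncomputable def ind (x : ℝ) : ℝ := if 0 < x then 1 else 0
noncomputable def npos (X : Matrix ι ι ℂ) : ℝ := trf ind X

lemma sum_ind (d : ι → ℝ) : ∑ i, ind (d i) = (Fintype.card {i // 0 < d i} : ℝ) := by
  unfold ind
  rw [Fintype.card_subtype, Finset.sum_ite]
  simp

lemma form_diag (d : ι → ℝ) (v : ι → ℂ) :
    (star v ⬝ᵥ (diagonal (fun i => (d i : ℂ)) *ᵥ v)).re = ∑ i, d i * Complex.normSq (v i) := by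
  simp only [dotProduct, mulVec_diagonal, Complex.re_sum]
  refine Finset.sum_congr rfl fun i _ => ?_
  simp [Complex.normSq_apply]
  ring

lemma inertia_le (d d' : ι → ℝ) (E : Matrix ι ι ℂ)
    (h : diagonal (fun i => (d i : ℂ)) = E * diagonal (fun i => (d' i : ℂ)) * Eᴴ) :
    Fintype.card {i // 0 < d i} ≤ Fintype.card {i // 0 < d' i} := by
  by_contra hlt
  push Not at hlt
  -- extension by zero
  let ext : ({i // 0 < d i} → ℂ) →ₗ[ℂ] (ι → ℂ) :=
    { toFun := fun v i => if hi : 0 < d i then v ⟨i, hi⟩ else 0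
      map_add' := by intro v w; ext i; by_cases hi : 0 < d i <;> simp [hi]
      map_smul' := by intro c v; ext i; by_cases hi : 0 < d i <;> simp [hi] }
  let res : (ι → ℂ) →ₗ[ℂ] ({i // 0 < d' i} → ℂ) := LinearMap.funLeft ℂ ℂ (fun i => i.1)
  let f := res ∘ₗ (Eᴴ.mulVecLin) ∘ₗ ext
  have hk : LinearMap.ker f ≠ ⊥ := LinearMap.ker_ne_bot_of_finrank_lt (by simpa using hlt)
  obtain ⟨v, hv, hv0⟩ := (Submodule.ne_bot_iff _).1 hk
  set w := ext v with hw
  have hz : ∀ j, 0 < d' j → (Eᴴ *ᵥ w) j = 0 := by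
    intro j hj
    have := congrFun (LinearMap.mem_ker.1 hv) ⟨j, hj⟩
    simpa [f, res, LinearMap.funLeft] using this
  have e1 : (star w ⬝ᵥ (diagonal (fun i => (d i : ℂ)) *ᵥ w)) =
      star (Eᴴ *ᵥ w) ⬝ᵥ (diagonal (fun i => (d' i : ℂ)) *ᵥ (Eᴴ *ᵥ w)) := by
    rw [h, star_mulVec, conjTranspose_conjTranspose, ← mulVec_mulVec, ← mulVec_mulVec,
      dotProduct_mulVec]
  have e2 := congrArg Complex.re e1
  rw [form_diag, form_diag] at e2
  have n1 : ∑ i, d' i * Complex.normSq ((Eᴴ *ᵥ w) i) ≤ 0 := by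
    refine Finset.sum_nonpos fun i _ => ?_
    by_cases hi : 0 < d' i
    · rw [hz i hi]; simp
    · exact mul_nonpos_of_nonpos_of_nonneg (not_lt.1 hi) (Complex.normSq_nonneg _)
  obtain ⟨i, hi⟩ := Function.ne_iff.1 hv0
  have n2 : 0 < ∑ i, d i * Complex.normSq (w i) := by
    refine Finset.sum_pos' (fun k _ => ?_) ⟨i.1, Finset.mem_univ _, ?_⟩
    · by_cases hk : 0 < d k
      · exact mul_nonneg hk.le (Complex.normSq_nonneg _)
      · have : w k = 0 := by simp [hw, ext, hk]
        simp [this]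
    · have : w i.1 = v i := by
        have := i.2
        simp [hw, ext, this]
      rw [this]
      exact mul_pos i.2 (Complex.normSq_pos.2 hi)
  linarith

lemma npos_congr (B : Matrix ι ι ℂ) (hB : IsUnit B) (d : ι → ℝ)
    (hX : (B * diagonal (fun i => (d i : ℂ)) * Bᴴ).IsHermitian) :
    npos (B * diagonal (fun i => (d i : ℂ)) * Bᴴ) = ∑ i, ind (d i) := by
  obtain ⟨U, d', h1, h2, h3⟩ := spec_s18 hX
  obtain ⟨C, hC⟩ := hB.exists_left_inv
  have hC' : Bᴴ * Cᴴ = 1 := by rw [← conjTranspose_mul, hC, conjTranspose_one]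
  rw [npos, h3, trf_conj _ _ _ h1, sum_ind, sum_ind]
  norm_cast
  apply le_antisymm
  · apply inertia_le _ _ (Uᴴ * B)
    calc _ = (Uᴴ * U) * diagonal (fun i => (d' i : ℂ)) * (Uᴴ * U) := by rw [h1]; simp
      _ = Uᴴ * (U * diagonal (fun i => (d' i : ℂ)) * Uᴴ) * U := by simp only [mul_assoc]
      _ = _ := by rw [← h3]; simp [mul_assoc]
  · apply inertia_le _ _ (C * U)
    calc _ = (C * B) * diagonal (fun i => (d i : ℂ)) * (Bᴴ * Cᴴ) := by rw [hC, hC']; simp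
      _ = C * (B * diagonal (fun i => (d i : ℂ)) * Bᴴ) * Cᴴ := by simp only [mul_assoc]
      _ = _ := by rw [h3]; simp [mul_assoc]

/-- Simultaneous diagonalisation. -/
lemma simul {A D : Matrix ι ι ℂ} (hA : A.PosDef) (hD : D.IsHermitian) :
    ∃ (B : Matrix ι ι ℂ) (k : ι → ℝ), IsUnit B ∧ A = B * Bᴴ ∧
      D = B * diagonal (fun i => (k i : ℂ)) * Bᴴ := by
  obtain ⟨U, d, h1, h2, h3⟩ := spec_s18 hA.1
  have hd : ∀ i, 0 < d i := by
    have : (diagonal (fun i => (d i : ℂ))).PosDef := by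
      have hU : IsUnit U := IsUnit.of_mul_eq_one _ h2
      rw [← Matrix.IsUnit.posDef_star_right_conjugate_iff hU]
      rw [h3] at hA
      exact hA
    intro i
    have := this.diag_pos (i := i)
    simpa using this
  set S := U * diagonal (fun i => ((Real.sqrt (d i) : ℝ) : ℂ)) with hS
  set T := diagonal (fun i => (((Real.sqrt (d i))⁻¹ : ℝ) : ℂ)) * Uᴴ with hT
  have hTS : T * S = 1 := by
    calc T * S = diagonal (fun i => (((Real.sqrt (d i))⁻¹ : ℝ) : ℂ)) * (Uᴴ * U) *
        diagonal (fun i => ((Real.sqrt (d i) : ℝ) : ℂ)) := by simp only [hS, hT, mul_assoc]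
      _ = 1 := by
        rw [h1, mul_one, diagonal_mul_diagonal, ← diagonal_one]
        congr 1; ext i
        rw [← Complex.ofReal_mul, inv_mul_cancel₀ (Real.sqrt_pos.2 (hd i)).ne']; simp
  have hST : S * T = 1 := mul_eq_one_comm.1 hTS
  have hSS : S * Sᴴ = A := by
    rw [h3, hS, conjTranspose_mul, diagonal_conjTranspose]
    calc _ = U * (diagonal (fun i => ((Real.sqrt (d i) : ℝ) : ℂ)) *
        diagonal (star fun i => ((Real.sqrt (d i) : ℝ) : ℂ))) * Uᴴ := by simp only [mul_assoc]
      _ = _ := by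
        rw [diagonal_mul_diagonal]
        congr 3; ext i
        simp only [Pi.star_apply, RCLike.star_def, Complex.conj_ofReal]
        rw [← Complex.ofReal_mul, Real.mul_self_sqrt (hd i).le]
  clear_value S T
  have hK : (T * D * Tᴴ).IsHermitian := by
    unfold Matrix.IsHermitian
    rw [conjTranspose_mul, conjTranspose_mul, hD.eq, conjTranspose_conjTranspose, mul_assoc]
  obtain ⟨V, k, g1, g2, g3⟩ := spec_s18 hK
  have hT' : Tᴴ * Sᴴ = 1 := by rw [← conjTranspose_mul, hST, conjTranspose_one]
  refine ⟨S * V, k, (IsUnit.of_mul_eq_one _ hST).mul (IsUnit.of_mul_eq_one _ g2), ?_, ?_⟩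
  · rw [conjTranspose_mul, ← hSS]
    calc _ = S * 1 * Sᴴ := by simp
      _ = _ := by rw [← g2]; simp only [mul_assoc]
  · rw [conjTranspose_mul]
    calc D = (S * T) * D * (Tᴴ * Sᴴ) := by rw [hST, hT']; simp
      _ = S * (T * D * Tᴴ) * Sᴴ := by simp only [mul_assoc]
      _ = _ := by rw [g3]; simp only [mul_assoc]

end inertia

section perc
variable {ι : Type} [Fintype ι] [DecidableEq ι]

noncomputable def NN (A D : Matrix ι ι ℂ) (s c : ℝ) : ℝ :=
  npos (D - s • (A + c • (1 : Matrix ι ι ℂ))) + npos (-D - s • (A + c • (1 : Matrix ι ι ℂ)))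

noncomputable def LL (A D : Matrix ι ι ℂ) (c : ℝ) : ℝ :=
  trf (fun x => Real.log (x + c)) A - 1 / 2 * trf (fun x => Real.log (x + c)) (A + D)
    - 1 / 2 * trf (fun x => Real.log (x + c)) (A - D)

lemma pd_shift {A : Matrix ι ι ℂ} (hA : A.PosSemidef) {c : ℝ} (hc : 0 < c) :
    (A + c • (1 : Matrix ι ι ℂ)).PosDef :=
  Matrix.PosDef.posSemidef_add hA (Matrix.PosDef.one.smul hc)

lemma trf_shift (f : ℝ → ℝ) {A : Matrix ι ι ℂ} (hA : A.IsHermitian) (c : ℝ) :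
    trf (fun x => f (x + c)) A = trf f (A + c • (1 : Matrix ι ι ℂ)) := by
  have := trf_affine f hA 1 c
  simp only [one_smul, one_mul] at this
  exact this.symm

lemma log_det_diag (B : Matrix ι ι ℂ) (d : ι → ℝ) (hd : ∀ i, 0 < d i) (hB : IsUnit B)
    (h : (B * diagonal (fun i => (d i : ℂ)) * Bᴴ).PosDef) :
    trf Real.log (B * diagonal (fun i => (d i : ℂ)) * Bᴴ) =
      Real.log (Complex.normSq B.det) + ∑ i, Real.log (d i) := by
  rw [trf_log_det h, det_mul, det_mul, det_conjTranspose, det_diagonal]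
  have hb : B.det ≠ 0 := ((Matrix.isUnit_iff_isUnit_det B).1 hB).ne_zero
  have : (B.det * ∏ i, (d i : ℂ)) * star B.det = ((Complex.normSq B.det * ∏ i, d i : ℝ) : ℂ) := by
    push_cast
    rw [Complex.normSq_eq_conj_mul_self, RCLike.star_def]
    ring
  rw [this, Complex.ofReal_re, Real.log_mul (Complex.normSq_pos.2 hb).ne'
    (Finset.prod_pos fun i _ => hd i).ne', Real.log_prod fun i _ => (hd i).ne']

lemma per_c {A D : Matrix ι ι ℂ} (hA : A.PosSemidef) (hD : D.IsHermitian)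
    (h1 : (A - D).PosSemidef) (h2 : (A + D).PosSemidef) {c : ℝ} (hc : 0 < c) :
    ∃ k : ι → ℝ, (∀ i, |k i| < 1) ∧
      (∀ s, NN A D s c = ∑ i, (ind (k i - s) + ind (-k i - s))) ∧
      LL A D c = ∑ i, (-(1 / 2) * Real.log (1 - k i ^ 2)) := by
  have hAc := pd_shift hA hc
  obtain ⟨B, k, hB, e1, e2⟩ := simul hAc hD
  have lin : ∀ a b : ℝ, a • (A + c • (1 : Matrix ι ι ℂ)) + b • D =
      B * diagonal (fun i => ((a + b * k i : ℝ) : ℂ)) * Bᴴ := by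
    intro a b
    have : diagonal (fun i => ((a + b * k i : ℝ) : ℂ)) =
        a • (1 : Matrix ι ι ℂ) + b • diagonal (fun i => (k i : ℂ)) := by
      ext i j
      by_cases hij : i = j
      · subst hij; simp
      · simp [hij]
    rw [this, mul_add, add_mul]
    conv_lhs => rw [e1, e2]
    simp
  have l1 : A + D + c • (1 : Matrix ι ι ℂ) = B * diagonal (fun i => ((1 + k i : ℝ) : ℂ)) * Bᴴ := by
    have := lin 1 1
    simp only [one_smul, one_mul] at this
    rw [← this]; abel
  have l2 : A - D + c • (1 : Matrix ι ι ℂ) = B * diagonal (fun i => ((1 - k i : ℝ) : ℂ)) * Bᴴ := by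
    have := lin 1 (-1)
    simp only [one_smul, neg_smul, neg_mul, one_mul, ← sub_eq_add_neg] at this
    rw [← this]; abel
  have l0 : A + c • (1 : Matrix ι ι ℂ) = B * diagonal (fun i => ((1 : ℝ) : ℂ)) * Bᴴ := by
    have := lin 1 0
    simpa using this
  have pdpos : ∀ d : ι → ℝ, (B * diagonal (fun i => (d i : ℂ)) * Bᴴ).PosDef → ∀ i, 0 < d i := by
    intro d h i
    have : (diagonal (fun i => (d i : ℂ))).PosDef := by
      rw [← Matrix.IsUnit.posDef_star_right_conjugate_iff hB]
      exact h
    have := this.diag_pos (i := i)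
    simpa using this
  have p1 := pd_shift h2 hc
  have p2 := pd_shift h1 hc
  have q1 := pdpos _ (l1 ▸ p1)
  have q2 := pdpos _ (l2 ▸ p2)
  refine ⟨k, fun i => abs_lt.2 ⟨by linarith [q1 i], by linarith [q2 i]⟩, ?_, ?_⟩
  · intro s
    have m1 : D - s • (A + c • (1 : Matrix ι ι ℂ)) =
        B * diagonal (fun i => ((k i - s : ℝ) : ℂ)) * Bᴴ := by
      have := lin (-s) 1
      simp only [one_smul, neg_smul, one_mul] at this
      rw [sub_eq_add_neg, add_comm, this]
      simp only [sub_eq_neg_add]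
    have m2 : -D - s • (A + c • (1 : Matrix ι ι ℂ)) =
        B * diagonal (fun i => ((-k i - s : ℝ) : ℂ)) * Bᴴ := by
      have := lin (-s) (-1)
      simp only [one_smul, neg_smul, neg_mul, one_mul] at this
      rw [sub_eq_add_neg, add_comm, this]
      simp only [sub_eq_neg_add]
    have r1 : (D - s • (A + c • (1 : Matrix ι ι ℂ))).IsHermitian :=
      hD.sub (herm_smul hAc.1 s)
    have r2 : (-D - s • (A + c • (1 : Matrix ι ι ℂ))).IsHermitian :=
      hD.neg.sub (herm_smul hAc.1 s)
    rw [NN, m1, m2, npos_congr B hB _ (m1 ▸ r1), npos_congr B hB _ (m2 ▸ r2),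
      Finset.sum_add_distrib]
  · rw [LL, trf_shift _ hA.1, trf_shift _ h1.1, trf_shift _ h2.1, l0, l1, l2,
      log_det_diag B (fun _ => 1) (fun _ => one_pos) hB (l0 ▸ hAc),
      log_det_diag B _ q1 hB (l1 ▸ p1), log_det_diag B _ q2 hB (l2 ▸ p2)]
    have : ∀ i, Real.log (1 - k i ^ 2) = Real.log (1 + k i) + Real.log (1 - k i) := by
      intro i
      rw [← Real.log_mul (q1 i).ne' (q2 i).ne']
      congr 1; ring
    simp only [this, mul_add, Finset.sum_add_distrib, ← Finset.mul_sum, Real.log_one]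
    simp
    ring

lemma LL_nonneg {A D : Matrix ι ι ℂ} (hA : A.PosSemidef) (hD : D.IsHermitian)
    (h1 : (A - D).PosSemidef) (h2 : (A + D).PosSemidef) {c : ℝ} (hc : 0 < c) : 0 ≤ LL A D c := by
  obtain ⟨k, hk, -, h⟩ := per_c hA hD h1 h2 hc
  rw [h]
  refine Finset.sum_nonneg fun i _ => ?_
  have := sq_lt_one_iff_abs_lt_one (k i) |>.2 (hk i)
  have := Real.log_nonpos (x := 1 - k i ^ 2) (by linarith) (by nlinarith [sq_nonneg (k i)])
  linarith

end perc

section cint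
open MeasureTheory Filter Topology
variable {ι : Type} [Fintype ι] [DecidableEq ι]

noncomputable def ff (x : ℝ) : ℝ := x * Real.log x

noncomputable def chi (A D : Matrix ι ι ℂ) : ℝ :=
  1 / 2 * trf ff (A + D) + 1 / 2 * trf ff (A - D) - trf ff A

noncomputable def FF (A D : Matrix ι ι ℂ) (c : ℝ) : ℝ :=
  trf (fun x => ff (x + c)) A - 1 / 2 * trf (fun x => ff (x + c)) (A + D)
    - 1 / 2 * trf (fun x => ff (x + c)) (A - D)

lemma trf_deriv {X : Matrix ι ι ℂ} (hX : X.PosSemidef) {c : ℝ} (hc : 0 < c) :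
    HasDerivAt (fun c => trf (fun x => ff (x + c)) X)
      (trf (fun x => Real.log (x + c)) X + Fintype.card ι) c := by
  have : (fun c => trf (fun x => ff (x + c)) X) =
      fun c => ∑ i, ff (hX.1.eigenvalues i + c) := by
    ext c; rw [trf_eq_eig _ hX.1]
  rw [this, trf_eq_eig _ hX.1]
  have h2 : ∑ i, Real.log (hX.1.eigenvalues i + c) + (Fintype.card ι : ℝ) =
      ∑ i, (Real.log (hX.1.eigenvalues i + c) + 1) := by
    rw [Finset.sum_add_distrib]; simp
  rw [h2]
  refine HasDerivAt.fun_sum fun i _ => ?_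
  have hp : hX.1.eigenvalues i + c ≠ 0 := by
    have := hX.eigenvalues_nonneg i
    linarith
  have := (Real.hasDerivAt_mul_log hp).comp_const_add (hX.1.eigenvalues i) c
  exact this

lemma trf_cont {X : Matrix ι ι ℂ} (hX : X.PosSemidef) :
    Continuous (fun c => trf (fun x => ff (x + c)) X) := by
  have : (fun c => trf (fun x => ff (x + c)) X) =
      fun c => ∑ i, ff (hX.1.eigenvalues i + c) := by
    ext c; rw [trf_eq_eig _ hX.1]
  rw [this]
  refine continuous_finsetSum _ fun i _ => ?_
  exact Real.continuous_mul_log.comp (continuous_const.add continuous_id)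

lemma trf_lim {X : Matrix ι ι ℂ} (hX : X.PosSemidef) :
    Tendsto (fun c => trf (fun x => ff (x + c)) X -
      ((1 + Real.log c) * X.trace.re + c * Real.log c * Fintype.card ι)) atTop (𝓝 0) := by
  have h0 : ∀ c, trf (fun x => ff (x + c)) X -
      ((1 + Real.log c) * X.trace.re + c * Real.log c * Fintype.card ι) =
      ∑ i, (ff (hX.1.eigenvalues i + c) - ((1 + Real.log c) * hX.1.eigenvalues i
        + c * Real.log c)) := by
    intro c
    rw [← trf_id hX.1, trf_eq_eig _ hX.1, trf_eq_eig _ hX.1]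
    simp only [Finset.sum_sub_distrib, Finset.sum_add_distrib, ← Finset.mul_sum]
    simp; ring
  simp only [h0]
  rw [show (0 : ℝ) = ∑ i : ι, 0 by simp]
  refine tendsto_finsetSum _ fun i _ => ?_
  have hx := hX.eigenvalues_nonneg i
  set x := hX.1.eigenvalues i
  have hlim : Tendsto (fun c : ℝ => x ^ 2 / c) atTop (𝓝 0) :=
    tendsto_const_nhds.div_atTop tendsto_id
  refine tendsto_of_tendsto_of_tendsto_of_le_of_le' tendsto_const_nhds hlim ?_ ?_
  · filter_upwards [eventually_gt_atTop 0] with c hc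
    have hp : 0 < x + c := by linarith
    have := Real.one_sub_inv_le_log_of_pos (div_pos hp hc)
    rw [Real.log_div hp.ne' hc.ne', inv_div] at this
    have := mul_le_mul_of_nonneg_left this hp.le
    have e : (x + c) * (1 - c / (x + c)) = x := by field_simp; ring
    rw [e] at this
    unfold ff
    nlinarith
  · filter_upwards [eventually_gt_atTop 0] with c hc
    have hp : 0 < x + c := by linarith
    have := Real.log_le_sub_one_of_pos (div_pos hp hc)
    rw [Real.log_div hp.ne' hc.ne'] at this
    have := mul_le_mul_of_nonneg_left this hp.le
    have e : (x + c) * ((x + c) / c - 1) = x ^ 2 / c + x := by field_simp; ring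
    rw [e] at this
    unfold ff
    nlinarith

lemma c_integral {A D : Matrix ι ι ℂ} (hA : A.PosSemidef) (hD : D.IsHermitian)
    (h1 : (A - D).PosSemidef) (h2 : (A + D).PosSemidef) :
    IntegrableOn (LL A D) (Set.Ioi 0) ∧ ∫ c in Set.Ioi (0 : ℝ), LL A D c = chi A D := by
  have hc : ContinuousWithinAt (FF A D) (Set.Ici 0) 0 := by
    refine Continuous.continuousWithinAt ?_
    unfold FF
    exact ((trf_cont hA).sub ((trf_cont h2).const_mul _)).sub ((trf_cont h1).const_mul _)
  have hd : ∀ c ∈ Set.Ioi (0 : ℝ), HasDerivAt (FF A D) (LL A D c) c := by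
    intro c hc
    have := ((trf_deriv hA hc).sub ((trf_deriv h2 hc).const_mul (1 / 2))).sub
      ((trf_deriv h1 hc).const_mul (1 / 2))
    refine this.congr_deriv ?_
    unfold LL
    ring
  have hn : ∀ c ∈ Set.Ioi (0 : ℝ), 0 ≤ LL A D c := fun c hc => LL_nonneg hA hD h1 h2 hc
  have hl : Tendsto (FF A D) atTop (𝓝 0) := by
    have := ((trf_lim hA).sub ((trf_lim h2).const_mul (1 / 2))).sub
      ((trf_lim h1).const_mul (1 / 2))
    simp only [mul_zero, sub_zero] at this
    refine this.congr fun c => ?_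
    unfold FF
    rw [trace_add, trace_sub, Complex.add_re, Complex.sub_re]
    ring
  refine ⟨integrableOn_Ioi_deriv_of_nonneg hc hd hn hl, ?_⟩
  rw [integral_Ioi_of_hasDerivAt_of_nonneg hc hd hn hl]
  unfold FF chi
  simp
  ring

end cint

section meas
open MeasureTheory Filter Topology
variable {ι : Type} [Fintype ι] [DecidableEq ι]

lemma ind_nonneg (x : ℝ) : 0 ≤ ind x := by unfold ind; split_ifs <;> norm_num

lemma ind_meas : Measurable ind := by
  unfold ind
  exact Measurable.ite measurableSet_Ioi measurable_const measurable_const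

lemma npos_shift {X A : Matrix ι ι ℂ} (hX : X.IsHermitian) (hA : A.IsHermitian) (s c : ℝ) :
    npos (X - s • (A + c • (1 : Matrix ι ι ℂ))) =
      ∑ i, ind ((hX.sub (herm_smul hA s)).eigenvalues i - s * c) := by
  have : X - s • (A + c • (1 : Matrix ι ι ℂ)) =
      (1 : ℝ) • (X - s • A) + (-(s * c)) • (1 : Matrix ι ι ℂ) := by
    rw [smul_add, smul_smul, one_smul, neg_smul]; abel
  rw [npos, this, trf_affine _ (hX.sub (herm_smul hA s)), trf_eq_eig _ (hX.sub (herm_smul hA s))]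
  simp [sub_eq_add_neg]

lemma NN_meas {A D : Matrix ι ι ℂ} (hA : A.PosSemidef) (hD : D.IsHermitian) (s : ℝ) :
    Measurable (fun c => NN A D s c) := by
  unfold NN
  simp only [npos_shift hD hA.1, npos_shift hD.neg hA.1]
  refine Measurable.add ?_ ?_ <;>
  · refine Finset.measurable_sum _ fun i _ => ?_
    exact ind_meas.comp (by fun_prop)

noncomputable def NP (A D : Matrix ι ι ℂ) (p : ℝ × ℝ) : ℝ :=
  if 0 < p.1 then NN A D p.2 p.1 else 0

lemma ind_tendsto (k s : ℝ) (u : ℕ → ℝ) (hu : ∀ m, s ≤ u m) (hl : Tendsto u atTop (𝓝 s)) :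
    Tendsto (fun m => ind (k - u m)) atTop (𝓝 (ind (k - s))) := by
  refine tendsto_const_nhds.congr' ?_
  by_cases h : s < k
  · filter_upwards [hl.eventually_lt_const h] with m hm
    simp [ind, h, hm]
  · refine Eventually.of_forall fun m => ?_
    have := hu m
    have h' : ¬ u m < k := by linarith
    simp [ind, h, h']

lemma approx_meas (g : ℝ × ℝ → ℝ) (hg : ∀ q, Measurable fun c => g (c, q)) (m : ℕ) :
    Measurable (fun p : ℝ × ℝ => g (p.1, ((⌊((m : ℝ) + 1) * p.2⌋ : ℝ) + 1) / ((m : ℝ) + 1))) := by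
  have a1 : Measurable (fun q : ℝ × ℤ => g (q.1, ((q.2 : ℝ) + 1) / ((m : ℝ) + 1))) :=
    measurable_from_prod_countable_left fun z => hg (((z : ℝ) + 1) / ((m : ℝ) + 1))
  have a2 : Measurable (fun p : ℝ × ℝ => (p.1, ⌊((m : ℝ) + 1) * p.2⌋)) := by
    refine measurable_fst.prodMk ?_
    exact Int.measurable_floor.comp (by fun_prop)
  exact a1.comp a2

lemma NP_fix {A D : Matrix ι ι ℂ} (hA : A.PosSemidef) (hD : D.IsHermitian) (q : ℝ) :
    Measurable fun c => NP A D (c, q) := by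
  unfold NP
  exact Measurable.ite measurableSet_Ioi (NN_meas hA hD _) measurable_const

lemma NP_meas {A D : Matrix ι ι ℂ} (hA : A.PosSemidef) (hD : D.IsHermitian)
    (h1 : (A - D).PosSemidef) (h2 : (A + D).PosSemidef) : Measurable (NP A D) := by
  refine measurable_of_tendsto_metrizable (approx_meas (NP A D) (NP_fix hA hD)) ?_
  rw [tendsto_pi_nhds]
  rintro ⟨c, s⟩
  have hge : ∀ m : ℕ, s ≤ ((⌊((m : ℝ) + 1) * s⌋ : ℝ) + 1) / ((m : ℝ) + 1) := by
    intro m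
    have hm : (0 : ℝ) < (m : ℝ) + 1 := by positivity
    rw [le_div_iff₀ hm]
    have := Int.lt_floor_add_one (((m : ℝ) + 1) * s)
    linarith
  have hle : ∀ m : ℕ, ((⌊((m : ℝ) + 1) * s⌋ : ℝ) + 1) / ((m : ℝ) + 1) ≤ s + 1 / ((m : ℝ) + 1) := by
    intro m
    have hm : (0 : ℝ) < (m : ℝ) + 1 := by positivity
    have e : (s + 1 / ((m : ℝ) + 1)) * ((m : ℝ) + 1) = ((m : ℝ) + 1) * s + 1 := by field_simp
    rw [div_le_iff₀ hm, e]
    have := Int.floor_le (((m : ℝ) + 1) * s)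
    linarith
  have hlim : Tendsto (fun m : ℕ => ((⌊((m : ℝ) + 1) * s⌋ : ℝ) + 1) / ((m : ℝ) + 1)) atTop (𝓝 s) := by
    refine tendsto_of_tendsto_of_tendsto_of_le_of_le tendsto_const_nhds ?_ hge hle
    have := (tendsto_one_div_add_atTop_nhds_zero_nat (𝕜 := ℝ)).const_add s
    simpa using this
  simp only [NP]
  by_cases hc : 0 < c
  · simp only [hc, if_true]
    obtain ⟨k, -, hk, -⟩ := per_c hA hD h1 h2 hc
    simp only [hk]
    refine tendsto_finsetSum _ fun i _ => ?_
    exact (ind_tendsto _ _ _ hge hlim).add (ind_tendsto _ _ _ hge hlim)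
  · simp [hc]

lemma lint_c (l s : ℝ) (hs : 0 < s) :
    ∫⁻ c in Set.Ioi (0 : ℝ), ENNReal.ofReal (ind (l - s * c)) = ENNReal.ofReal (max l 0 / s) := by
  have : ∀ c : ℝ, ENNReal.ofReal (ind (l - s * c)) = (Set.Iio (l / s)).indicator (fun _ => 1) c := by
    intro c
    unfold ind
    by_cases h : c < l / s
    · rw [Set.indicator_of_mem (by exact h), if_pos]
      · simp
      · rw [lt_div_iff₀ hs] at h; linarith
    · rw [Set.indicator_of_notMem (by exact h), if_neg]
      · simp
      · rw [lt_div_iff₀ hs] at h; linarith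
  simp only [this]
  rw [lintegral_indicator_const measurableSet_Iio, one_mul, Measure.restrict_apply measurableSet_Iio,
    Set.inter_comm, Set.Ioi_inter_Iio, Real.volume_Ioo, sub_zero]
  rcases le_total l 0 with h | h
  · rw [max_eq_right h, zero_div, ENNReal.ofReal_of_nonpos (div_nonpos_of_nonpos_of_nonneg h hs.le)]
    simp
  · rw [max_eq_left h]

lemma lint_s (k : ℝ) (hk : |k| < 1) :
    ∫⁻ s in Set.Ioo (0 : ℝ) 1, ENNReal.ofReal (s / (1 - s ^ 2) * (ind (k - s) + ind (-k - s))) =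
      ENNReal.ofReal (-(1 / 2) * Real.log (1 - k ^ 2)) := by
  have e1 : ∀ s ∈ Set.Ioo (0 : ℝ) 1,
      ENNReal.ofReal (s / (1 - s ^ 2) * (ind (k - s) + ind (-k - s))) =
      (Set.Iio |k|).indicator (fun s => ENNReal.ofReal (s / (1 - s ^ 2))) s := by
    intro s hs
    have : ind (k - s) + ind (-k - s) = if s < |k| then 1 else 0 := by
      unfold ind
      have := hs.1
      rcases abs_cases k with ⟨h, h'⟩ | ⟨h, h'⟩ <;> rw [h] <;> split_ifs <;> linarith
    rw [this]
    by_cases h : s < |k|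
    · rw [Set.indicator_of_mem (by exact h), if_pos h, mul_one]
    · rw [Set.indicator_of_notMem (by exact h), if_neg h]; simp
  rw [setLIntegral_congr_fun measurableSet_Ioo e1, lintegral_indicator measurableSet_Iio,
    Measure.restrict_restrict measurableSet_Iio]
  have e2 : Set.Iio |k| ∩ Set.Ioo 0 1 = Set.Ioo 0 |k| := by
    ext x; simp only [Set.mem_inter_iff, Set.mem_Iio, Set.mem_Ioo]
    constructor
    · rintro ⟨a, b, c⟩; exact ⟨b, a⟩
    · rintro ⟨a, b⟩; exact ⟨b, a, b.trans hk⟩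
  have hpos : ∀ s ∈ Set.uIcc 0 |k|, 0 < 1 - s ^ 2 := by
    intro s hs
    rw [Set.uIcc_of_le (abs_nonneg k)] at hs
    nlinarith [hs.1, hs.2]
  have hd : ∀ s ∈ Set.uIcc 0 |k|,
      HasDerivAt (fun s => -(1 / 2) * Real.log (1 - s ^ 2)) (s / (1 - s ^ 2)) s := by
    intro s hs
    have h := hpos s hs
    have h3 : HasDerivAt (fun s : ℝ => 1 - s ^ 2) (-(2 * s)) s := by
      simpa using (hasDerivAt_pow 2 s).const_sub 1
    have := (h3.log h.ne').const_mul (-(1 / 2))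
    refine this.congr_deriv ?_
    field_simp
  have hc : ContinuousOn (fun s : ℝ => s / (1 - s ^ 2)) (Set.uIcc 0 |k|) := by
    refine ContinuousOn.div (by fun_prop) (by fun_prop) fun s hs => (hpos s hs).ne'
  have hi := hc.intervalIntegrable (μ := volume)
  have := intervalIntegral.integral_eq_sub_of_hasDerivAt hd hi
  rw [intervalIntegral.integral_of_le (abs_nonneg k)] at this
  have hi' := (intervalIntegrable_iff_integrableOn_Ioc_of_le (abs_nonneg k)).1 hi
  rw [e2, restrict_Ioo_eq_restrict_Ioc, ← ofReal_integral_eq_lintegral_ofReal hi', this]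
  · simp
  · filter_upwards [ae_restrict_mem measurableSet_Ioc] with s hs
    have := hpos s (by rw [Set.uIcc_of_le (abs_nonneg k)]; exact ⟨hs.1.le, hs.2⟩)
    exact div_nonneg hs.1.le this.le

lemma LL_lint {A D : Matrix ι ι ℂ} (hA : A.PosSemidef) (hD : D.IsHermitian)
    (h1 : (A - D).PosSemidef) (h2 : (A + D).PosSemidef) {c : ℝ} (hc : 0 < c) :
    ∫⁻ s in Set.Ioo (0 : ℝ) 1, ENNReal.ofReal (s / (1 - s ^ 2) * NP A D (c, s)) =
      ENNReal.ofReal (LL A D c) := by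
  obtain ⟨k, hk, hN, hL⟩ := per_c hA hD h1 h2 hc
  have hw : ∀ s ∈ Set.Ioo (0 : ℝ) 1, ENNReal.ofReal (s / (1 - s ^ 2) * NP A D (c, s)) =
      ∑ i, ENNReal.ofReal (s / (1 - s ^ 2) * (ind (k i - s) + ind (-k i - s))) := by
    intro s hs
    rw [NP, if_pos hc, hN, Finset.mul_sum, ENNReal.ofReal_sum_of_nonneg]
    intro i _
    refine mul_nonneg (div_nonneg hs.1.le ?_) (add_nonneg (ind_nonneg _) (ind_nonneg _))
    nlinarith [hs.1, hs.2]
  rw [setLIntegral_congr_fun measurableSet_Ioo hw, lintegral_finsetSum, hL,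
    ENNReal.ofReal_sum_of_nonneg]
  · exact Finset.sum_congr rfl fun i _ => lint_s _ (hk i)
  · intro i _
    have := sq_lt_one_iff_abs_lt_one (k i) |>.2 (hk i)
    have := Real.log_nonpos (x := 1 - k i ^ 2) (by linarith) (by nlinarith [sq_nonneg (k i)])
    linarith
  · intro i _
    refine ENNReal.measurable_ofReal.comp (Measurable.mul (by fun_prop) (Measurable.add ?_ ?_)) <;>
    exact ind_meas.comp (by fun_prop)

lemma npos_lint {X A : Matrix ι ι ℂ} (hX : X.IsHermitian) (hA : A.IsHermitian) {s : ℝ}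
    (hs : 0 < s) :
    ∫⁻ c in Set.Ioi (0 : ℝ), ENNReal.ofReal (npos (X - s • (A + c • (1 : Matrix ι ι ℂ)))) =
      ENNReal.ofReal (tp (X - s • A) / s) := by
  simp only [npos_shift hX hA]
  rw [tp, trf_eq_eig _ (hX.sub (herm_smul hA s)), Finset.sum_div,
    ENNReal.ofReal_sum_of_nonneg fun i _ => div_nonneg (le_max_right _ _) hs.le]
  have : ∀ c : ℝ, ENNReal.ofReal (∑ i, ind ((hX.sub (herm_smul hA s)).eigenvalues i - s * c)) =
      ∑ i, ENNReal.ofReal (ind ((hX.sub (herm_smul hA s)).eigenvalues i - s * c)) :=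
    fun c => ENNReal.ofReal_sum_of_nonneg fun i _ => ind_nonneg _
  simp only [this]
  rw [lintegral_finsetSum]
  · exact Finset.sum_congr rfl fun i _ => lint_c _ _ hs
  · intro i _
    exact ENNReal.measurable_ofReal.comp (ind_meas.comp (by fun_prop))

lemma npos_nonneg {X : Matrix ι ι ℂ} (hX : X.IsHermitian) : 0 ≤ npos X := by
  rw [npos, trf_eq_eig _ hX]
  exact Finset.sum_nonneg fun i _ => ind_nonneg _

lemma npos_meas {X A : Matrix ι ι ℂ} (hX : X.IsHermitian) (hA : A.IsHermitian) (s : ℝ) :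
    Measurable fun c : ℝ => ENNReal.ofReal (npos (X - s • (A + c • (1 : Matrix ι ι ℂ)))) := by
  simp only [npos_shift hX hA]
  refine ENNReal.measurable_ofReal.comp (Finset.measurable_sum _ fun i _ => ?_)
  exact ind_meas.comp (by fun_prop)

lemma inner_c {A D : Matrix ι ι ℂ} (hA : A.PosSemidef) (hD : D.IsHermitian) {s : ℝ}
    (hs : s ∈ Set.Ioo (0 : ℝ) 1) :
    ∫⁻ c in Set.Ioi (0 : ℝ), ENNReal.ofReal (s / (1 - s ^ 2) * NP A D (c, s)) =
      ENNReal.ofReal (eE A D s / (1 - s ^ 2)) := by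
  have h1 : 0 < 1 - s ^ 2 := by nlinarith [hs.1, hs.2]
  have hw : 0 ≤ s / (1 - s ^ 2) := div_nonneg hs.1.le h1.le
  have hsh : ∀ c : ℝ, (s • (A + c • (1 : Matrix ι ι ℂ))).IsHermitian := fun c =>
    herm_smul (hA.1.add (herm_smul isHermitian_one c)) s
  have e : ∀ c ∈ Set.Ioi (0 : ℝ), ENNReal.ofReal (s / (1 - s ^ 2) * NP A D (c, s)) =
      ENNReal.ofReal (s / (1 - s ^ 2)) *
        (ENNReal.ofReal (npos (D - s • (A + c • (1 : Matrix ι ι ℂ)))) +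
         ENNReal.ofReal (npos (-D - s • (A + c • (1 : Matrix ι ι ℂ))))) := by
    intro c hc
    rw [NP, if_pos (Set.mem_Ioi.1 hc), NN, ENNReal.ofReal_mul hw, ENNReal.ofReal_add]
    · exact npos_nonneg (hD.sub (hsh c))
    · exact npos_nonneg (hD.neg.sub (hsh c))
  rw [setLIntegral_congr_fun measurableSet_Ioi e, lintegral_const_mul,
    lintegral_add_left (npos_meas hD hA.1 s), npos_lint hD hA.1 hs.1, npos_lint hD.neg hA.1 hs.1,
    ← ENNReal.ofReal_add (div_nonneg (tp_nonneg _) hs.1.le) (div_nonneg (tp_nonneg _) hs.1.le),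
    ← ENNReal.ofReal_mul hw, eE]
  · congr 1
    have := hs.1.ne'
    field_simp
  · exact (npos_meas hD hA.1 s).add (npos_meas hD.neg hA.1 s)

theorem chi_formula {A D : Matrix ι ι ℂ} (hA : A.PosSemidef) (hD : D.IsHermitian)
    (h1 : (A - D).PosSemidef) (h2 : (A + D).PosSemidef) :
    IntegrableOn (fun s => eE A D s / (1 - s ^ 2)) (Set.Ioo 0 1) ∧
      ∫ s in Set.Ioo (0 : ℝ) 1, eE A D s / (1 - s ^ 2) = chi A D := by
  obtain ⟨hi, hv⟩ := c_integral hA hD h1 h2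
  have hnn : 0 ≤ᵐ[volume.restrict (Set.Ioi 0)] LL A D := by
    filter_upwards [ae_restrict_mem measurableSet_Ioi] with c hc
    exact LL_nonneg hA hD h1 h2 hc
  have a1 := ofReal_integral_eq_lintegral_ofReal hi hnn
  rw [hv, ← setLIntegral_congr_fun measurableSet_Ioi
    (fun c hc => LL_lint hA hD h1 h2 hc), lintegral_lintegral_swap] at a1
  · rw [setLIntegral_congr_fun measurableSet_Ioo (fun s hs => inner_c hA hD hs)] at a1
    have hm : Measurable fun s => eE A D s / (1 - s ^ 2) :=
      ((eE_antitone hA hD).measurable).div (by fun_prop)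
    have hp : 0 ≤ᵐ[volume.restrict (Set.Ioo 0 1)] fun s => eE A D s / (1 - s ^ 2) := by
      filter_upwards [ae_restrict_mem measurableSet_Ioo] with s hs
      have h1 : 0 < 1 - s ^ 2 := by nlinarith [hs.1, hs.2]
      exact div_nonneg (eE_nonneg _ _ _) h1.le
    refine ⟨⟨hm.aestronglyMeasurable, ?_⟩, ?_⟩
    · rw [hasFiniteIntegral_iff_ofReal hp, ← a1]
      exact ENNReal.ofReal_lt_top
    · rw [integral_eq_lintegral_of_nonneg_ae hp hm.aestronglyMeasurable, ← a1,
        ENNReal.toReal_ofReal]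
      rw [← hv]
      exact integral_nonneg_of_ae hnn
  · refine Measurable.aemeasurable ?_
    refine ENNReal.measurable_ofReal.comp (Measurable.mul (by fun_prop) ?_)
    exact NP_meas hA hD h1 h2

end meas

section scalar
open MeasureTheory

lemma int_lower {g h P : ℝ → ℝ} {b : ℝ} (hb0 : 0 ≤ b) (hb1 : b ≤ 1)
    (hg : IntegrableOn g (Set.Ioo 0 1)) (hg0 : ∀ s ∈ Set.Ioo (0 : ℝ) 1, 0 ≤ g s)
    (hc : ContinuousOn h (Set.Icc 0 b)) (hP : ∀ s ∈ Set.Icc 0 b, HasDerivAt P (h s) s)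
    (hle : ∀ s ∈ Set.Ioo 0 b, h s ≤ g s) : P b - P 0 ≤ ∫ s in Set.Ioo (0 : ℝ) 1, g s := by
  rw [← Set.uIcc_of_le hb0] at hc hP
  have hi := hc.intervalIntegrable (μ := volume)
  have e := intervalIntegral.integral_eq_sub_of_hasDerivAt hP hi
  have hi' := (intervalIntegrable_iff_integrableOn_Ioo_of_le hb0).1 hi
  rw [intervalIntegral.integral_of_le hb0, ← restrict_Ioo_eq_restrict_Ioc] at e
  have hsub : Set.Ioo 0 b ⊆ Set.Ioo (0 : ℝ) 1 := Set.Ioo_subset_Ioo_right hb1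
  rw [← e]
  calc _ ≤ ∫ s in Set.Ioo 0 b, g s :=
        setIntegral_mono_on hi' (hg.mono_set hsub) measurableSet_Ioo hle
    _ ≤ _ := setIntegral_mono_set hg
        (by filter_upwards [ae_restrict_mem measurableSet_Ioo] with s hs using hg0 s hs)
        hsub.eventuallyLE

lemma int_upper {e : ℝ → ℝ} {m : ℝ} 
    (hg : IntegrableOn (fun s => e s / (1 - s ^ 2)) (Set.Ioo 0 1))
    (hle : ∀ s ∈ Set.Ioo (0 : ℝ) 1, e s ≤ (1 - s) * m) :
    ∫ s in Set.Ioo (0 : ℝ) 1, e s / (1 - s ^ 2) ≤ m * Real.log 2 := by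
  have hP : ∀ s ∈ Set.uIcc (0 : ℝ) 1, HasDerivAt (fun s => m * Real.log (1 + s)) (m / (1 + s)) s := by
    intro s hs
    rw [Set.uIcc_of_le zero_le_one] at hs
    have h : (1 + s) ≠ 0 := by linarith [hs.1]
    have := (((hasDerivAt_id s).const_add 1).log h).const_mul m
    refine this.congr_deriv ?_
    simp [div_eq_mul_inv]
  have hc : ContinuousOn (fun s : ℝ => m / (1 + s)) (Set.uIcc 0 1) := by
    refine ContinuousOn.div (by fun_prop) (by fun_prop) fun s hs => ?_
    rw [Set.uIcc_of_le zero_le_one] at hs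
    linarith [hs.1]
  have hi := hc.intervalIntegrable (μ := volume)
  have e' := intervalIntegral.integral_eq_sub_of_hasDerivAt hP hi
  have hi' := (intervalIntegrable_iff_integrableOn_Ioo_of_le zero_le_one).1 hi
  rw [intervalIntegral.integral_of_le zero_le_one, ← restrict_Ioo_eq_restrict_Ioc] at e'
  have hv : m * Real.log (1 + 1) - m * Real.log (1 + 0) = m * Real.log 2 := by norm_num
  rw [← hv, ← e']
  refine setIntegral_mono_on hg hi' measurableSet_Ioo fun s hs => ?_
  have h1 : 0 < 1 - s := by linarith [hs.2]
  have h2 : 0 < 1 + s := by linarith [hs.1]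
  rw [div_le_div_iff₀ (by nlinarith) h2]
  nlinarith [hle s hs]

lemma scalar_bounds {e₁ e₂ : ℝ → ℝ} {η : ℝ} (h0 : 0 ≤ η) (h1 : η ≤ 1)
    (g1 : IntegrableOn (fun s => e₁ s / (1 - s ^ 2)) (Set.Ioo 0 1))
    (g2 : IntegrableOn (fun s => e₂ s / (1 - s ^ 2)) (Set.Ioo 0 1))
    (n1 : ∀ s, 0 ≤ e₁ s)
    (l1 : ∀ s, η - s ≤ e₁ s)
    (u2 : ∀ s ∈ Set.Ioo (0 : ℝ) 1, e₂ s ≤ (1 - s) * η ^ 2)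
    (c12 : ∀ s, e₂ s ≤ e₁ s) :
    η ^ 2 / 2 ≤ ∫ s in Set.Ioo (0 : ℝ) 1, e₁ s / (1 - s ^ 2) ∧
    (η < 1 → (1 + η) / 2 * Real.log (1 + η) + (1 - η) / 2 * Real.log (1 - η) ≤
      ∫ s in Set.Ioo (0 : ℝ) 1, e₁ s / (1 - s ^ 2)) ∧
    (η = 1 → Real.log 2 ≤ ∫ s in Set.Ioo (0 : ℝ) 1, e₁ s / (1 - s ^ 2)) ∧
    (1 - η) * η ^ 2 / (2 * (1 + η)) ≤ (∫ s in Set.Ioo (0 : ℝ) 1, e₁ s / (1 - s ^ 2)) -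
      ∫ s in Set.Ioo (0 : ℝ) 1, e₂ s / (1 - s ^ 2) := by
  have w : ∀ s ∈ Set.Ioo (0 : ℝ) 1, 0 < 1 - s ^ 2 ∧ 1 - s ^ 2 ≤ 1 := by
    intro s hs
    constructor <;> nlinarith [hs.1, hs.2]
  have p1 : ∀ s ∈ Set.Ioo (0 : ℝ) 1, 0 ≤ e₁ s / (1 - s ^ 2) := fun s hs =>
    div_nonneg (n1 s) (w s hs).1.le
  have lin : ∀ p q s : ℝ, HasDerivAt (fun s => p * s - q * s ^ 2 / 2) (p - q * s) s := by
    intro p q s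
    have := ((hasDerivAt_id s).const_mul p).sub ((((hasDerivAt_pow 2 s).const_mul q)).div_const 2)
    refine this.congr_deriv ?_
    simp; ring
  refine ⟨?_, ?_, ?_, ?_⟩
  · have := int_lower (h := fun s => η - 1 * s) h0 h1 g1 p1 (by fun_prop) (fun s _ => lin η 1 s) ?_
    · refine le_trans (le_of_eq ?_) this
      ring
    · intro s hs
      have hs1 : s ∈ Set.Ioo (0 : ℝ) 1 := ⟨hs.1, hs.2.trans_le h1⟩
      obtain ⟨w1, w2⟩ := w s hs1
      rw [le_div_iff₀ w1]
      nlinarith [l1 s, hs.1, hs.2]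
  · intro hlt
    have := int_lower (h := fun s => (η - s) / (1 - s ^ 2))
      (P := fun s => (1 + η) / 2 * Real.log (1 + s) + (1 - η) / 2 * Real.log (1 - s))
      h0 h1 g1 p1 ?_ ?_ ?_
    · simpa using this
    · refine ContinuousOn.div (by fun_prop) (by fun_prop) fun s hs => ?_
      nlinarith [hs.1, hs.2]
    · intro s hs
      have a : (1 + s) ≠ 0 := by linarith [hs.1]
      have b : (1 - s) ≠ 0 := by linarith [hs.2]
      have c : 1 - s ^ 2 ≠ 0 := by nlinarith [hs.1, hs.2]
      have := ((((hasDerivAt_id s).const_add 1).log a).const_mul ((1 + η) / 2)).add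
        ((((hasDerivAt_id s).const_sub 1).log b).const_mul ((1 - η) / 2))
      refine this.congr_deriv ?_
      rw [show 1 - s ^ 2 = (1 + s) * (1 - s) by ring]
      simp only [id]
      field_simp
      ring
    · intro s hs
      have hs1 : s ∈ Set.Ioo (0 : ℝ) 1 := ⟨hs.1, hs.2.trans_le h1⟩
      exact div_le_div_of_nonneg_right (l1 s) (w s hs1).1.le
  · intro h
    subst h
    have := int_lower (h := fun s => 1 / (1 + s)) (P := fun s => Real.log (1 + s))
      zero_le_one le_rfl g1 p1 ?_ ?_ ?_
    · norm_num at this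
      exact this
    · refine ContinuousOn.div (by fun_prop) (by fun_prop) fun s hs => ?_
      linarith [hs.1]
    · intro s hs
      have a : (1 + s) ≠ 0 := by linarith [hs.1]
      exact ((hasDerivAt_id s).const_add 1).log a
    · intro s hs
      have h1 : 0 < 1 - s := by linarith [hs.2]
      have h2 : 0 < 1 + s := by linarith [hs.1]
      rw [div_le_div_iff₀ h2 (w s hs).1]
      nlinarith [l1 s]
  · rw [← integral_sub g1 g2]
    have hb0 : 0 ≤ η / (1 + η) := by positivity
    have hb1 : η / (1 + η) ≤ 1 := by rw [div_le_one (by linarith)]; linarith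
    have := int_lower (h := fun s => (1 - η) * η - (1 - η ^ 2) * s) hb0 hb1 (g1.sub g2) ?_
      (by fun_prop) (fun s _ => lin ((1 - η) * η) (1 - η ^ 2) s) ?_
    · refine le_trans (le_of_eq ?_) this
      have : 1 + η ≠ 0 := by linarith
      field_simp
      ring
    · intro s hs
      simp only [Pi.sub_apply]
      rw [← sub_div]
      exact div_nonneg (sub_nonneg.2 (c12 s)) (w s hs).1.le
    · intro s hs
      have hs1 : s ∈ Set.Ioo (0 : ℝ) 1 := ⟨hs.1, hs.2.trans_le hb1⟩
      obtain ⟨w1, w2⟩ := w s hs1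
      simp only [Pi.sub_apply]
      rw [← sub_div, le_div_iff₀ w1]
      have h3 : s * (1 + η) < η := (lt_div_iff₀ (by linarith)).1 hs.2
      have h4 : 0 ≤ (1 - η) * η - (1 - η ^ 2) * s := by nlinarith
      have := l1 s
      have := u2 s hs1
      nlinarith

lemma numerics {x₁ x₂ η H : ℝ} (h0 : 0 ≤ η) (h1 : η ≤ 1) (hH : H = Real.log 2 - x₁)
    (u1 : x₁ ≤ η * Real.log 2) (u2 : x₂ ≤ η ^ 2 * Real.log 2)
    (a1 : η ^ 2 / 2 ≤ x₁)
    (a2 : η < 1 → (1 + η) / 2 * Real.log (1 + η) + (1 - η) / 2 * Real.log (1 - η) ≤ x₁)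
    (a3 : η = 1 → Real.log 2 ≤ x₁)
    (a4 : (1 - η) * η ^ 2 / (2 * (1 + η)) ≤ x₁ - x₂) :
    (0 < H → H ≤ Real.log 2 / 2 → 0.083 * (H / (1 - Real.log H)) ≤ x₁ - x₂) ∧
    (Real.log 2 / 2 ≤ H → H < Real.log 2 →
      0.083 * ((Real.log 2 - H) / (1 - Real.log (Real.log 2 - H))) ≤ x₁ - x₂) := by
  have l2 := Real.log_two_gt_d9
  have l2' := Real.log_two_lt_d9
  constructor
  · intro hp hle
    have hη : 1 / 2 ≤ η := by nlinarith
    have hlt : η < 1 := lt_of_le_of_ne h1 fun h => by linarith [a3 h]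
    have b := a2 hlt
    obtain ⟨p, rfl⟩ : ∃ p, η = 1 - 2 * p := ⟨(1 - η) / 2, by ring⟩
    have hp0 : 0 < p := by linarith
    have hp1 : p ≤ 1 / 4 := by linarith
    have hq : 0 < 1 - p := by linarith
    rw [show 1 + (1 - 2 * p) = 2 * (1 - p) by ring, show 1 - (1 - 2 * p) = 2 * p by ring,
      Real.log_mul two_ne_zero hq.ne', Real.log_mul two_ne_zero hp0.ne'] at b
    have c1 := Real.one_sub_inv_le_log_of_pos hq
    have c2 : -p ≤ (1 - p) * Real.log (1 - p) := by
      have := mul_le_mul_of_nonneg_left c1 hq.le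
      have e : (1 - p) * (1 - (1 - p)⁻¹) = -p := by field_simp; ring
      linarith
    set L := 1 - Real.log p with hL
    have hHL : H ≤ p * L := by rw [hL]; nlinarith
    have hL1 : 1 < L := by
      have := Real.log_neg hp0 (by linarith)
      linarith
    have hL0 : 0 < L := by linarith
    have d1 : Real.log L ≤ 0.368 * L := by
      have e1 := Real.exp_one_gt_d9
      have := Real.log_le_sub_one_of_pos (div_pos hL0 (Real.exp_pos 1))
      rw [Real.log_div hL0.ne' (Real.exp_pos 1).ne', Real.log_exp] at this
      have : L / Real.exp 1 ≤ 0.368 * L := by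
        rw [div_le_iff₀ (Real.exp_pos 1)]
        nlinarith
      linarith
    have d2 : Real.log H ≤ Real.log p + Real.log L := by
      rw [← Real.log_mul hp0.ne' hL0.ne']
      exact Real.log_le_log hp hHL
    have d3 : 0 < 1 - Real.log H := by
      have := Real.log_neg hp (by linarith)
      linarith
    have d4 : H / (1 - Real.log H) ≤ 1.6 * p := by
      rw [div_le_iff₀ d3]
      have : 0.632 * L ≤ 1 - Real.log H := by linarith
      have := mul_le_mul_of_nonneg_left this hp0.le
      nlinarith
    have d5 : 0.083 * (1.6 * p) ≤ (1 - (1 - 2 * p)) * (1 - 2 * p) ^ 2 / (2 * (1 + (1 - 2 * p))) := by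
      rw [le_div_iff₀ (by linarith)]
      have : 0.083 * 1.6 * (2 * (1 + (1 - 2 * p))) ≤ 2 * (1 - 2 * p) ^ 2 := by nlinarith
      have := mul_le_mul_of_nonneg_left this hp0.le
      nlinarith
    nlinarith
  · intro hge hlt
    have hx : Real.log 2 - H = x₁ := by rw [hH]; ring
    rw [hx]
    have x0 : 0 < x₁ := by linarith
    have x1 : x₁ ≤ Real.log 2 / 2 := by linarith
    have lx : Real.log x₁ ≤ -1 := by
      have t1 := Real.log_le_log x0 x1
      rw [Real.log_div (by linarith) two_ne_zero] at t1
      have := Real.log_le_sub_one_of_pos (show 0 < Real.log 2 by linarith)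
      linarith
    have r : x₁ / (1 - Real.log x₁) ≤ x₁ / 2 :=
      div_le_div_of_nonneg_left x0.le two_pos (by linarith)
    have hη : η ≤ 0.833 := by nlinarith
    suffices 0.0415 * x₁ ≤ x₁ - x₂ by linarith
    by_contra hcon
    push Not at hcon
    have k1 : (1 - η) * η ^ 2 / (2 * (1 + η)) < 0.0415 * x₁ := lt_of_le_of_lt a4 hcon
    have k2 : 0.9585 * x₁ < η ^ 2 * 0.6932 := by nlinarith [sq_nonneg η]
    have k3 : (1 - η) / (2 * (1 + η)) ≥ 0.0455 := by
      rw [ge_iff_le, le_div_iff₀ (by linarith)]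
      linarith
    have k4 : (1 - η) * η ^ 2 / (2 * (1 + η)) = (1 - η) / (2 * (1 + η)) * η ^ 2 := by ring
    rw [k4] at k1
    have := mul_le_mul_of_nonneg_right k3 (sq_nonneg η)
    nlinarith

end scalar

lemma vN_chi {ι : Type} [Fintype ι] [DecidableEq ι] {A D : Matrix ι ι ℂ} (hA : A.PosSemidef)
    (h1 : (A - D).PosSemidef) (h2 : (A + D).PosSemidef) :
    chi A D = vN A - 1 / 2 * vN (A + D) - 1 / 2 * vN (A - D) := by
  have key : ∀ {X : Matrix ι ι ℂ}, X.IsHermitian → trf ff X = - vN X := by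
    intro X hX
    rw [vN_eq hX, trf_eq_eig _ hX, trf_eq_eig _ hX, ← Finset.sum_neg_distrib]
    refine Finset.sum_congr rfl fun i _ => ?_
    simp [ff, Real.negMulLog]
  rw [chi, key hA.1, key h1.1, key h2.1]
  ring

theorem main_aux (d : ℕ) (A D : Matrix (Fin d) (Fin d) ℂ) (hA : A.PosSemidef)
    (hD : D.IsHermitian) (h1 : (A - D).PosSemidef) (h2 : (A + D).PosSemidef)
    (t1 : (A - D).trace = 1) (t2 : (A + D).trace = 1)
    (k1 : (A ⊗ₖ A - D ⊗ₖ D).PosSemidef) (k2 : (A ⊗ₖ A + D ⊗ₖ D).PosSemidef) (H G : ℝ)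
    (hH : H = Real.log 2 - chi A D) (hG : G = Real.log 2 - chi (A ⊗ₖ A) (D ⊗ₖ D)) :
    (0 < H → H ≤ Real.log 2 / 2 → G ≥ H + 0.083 * (H / (1 - Real.log H))) ∧
    (Real.log 2 / 2 ≤ H → H < Real.log 2 →
      G ≥ H + 0.083 * ((Real.log 2 - H) / (1 - Real.log (Real.log 2 - H)))) := by
  have kA : (A ⊗ₖ A).PosSemidef := hA.kronecker hA
  have kD := herm_kron hD hD
  have tA : A.trace.re = 1 := by
    rw [trace_sub] at t1
    rw [trace_add] at t2
    have e : A.trace = 1 := by linear_combination (t1 + t2) / 2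
    rw [e]; simp
  obtain ⟨i1, v1⟩ := chi_formula hA hD h1 h2
  obtain ⟨i2, v2⟩ := chi_formula kA kD k1 k2
  have h0 := eE_nonneg A D 0
  have l1 : ∀ s, eE A D 0 - s ≤ eE A D s := by
    intro s
    have := eE_lower hA hD s
    rw [tA] at this
    linarith
  have hη : eE A D 0 ≤ 1 := by
    have := l1 1
    have := eE_upper hA hD h1 h2 zero_le_one le_rfl
    linarith
  have u2 : ∀ s ∈ Set.Ioo (0 : ℝ) 1, eE (A ⊗ₖ A) (D ⊗ₖ D) s ≤ (1 - s) * (eE A D 0) ^ 2 := by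
    intro s hs
    refine (eE_upper kA kD k1 k2 hs.1.le hs.2.le).trans ?_
    exact mul_le_mul_of_nonneg_left (eE0_tensor hD) (by linarith [hs.2])
  obtain ⟨a1, a2, a3, a4⟩ := scalar_bounds h0 hη i1 i2 (eE_nonneg A D) l1 u2
    (eE_tensor hA hD h1 h2 t1 t2)
  have b1 := int_upper i1 (fun s hs => eE_upper hA hD h1 h2 hs.1.le hs.2.le)
  have b2 := int_upper i2 u2
  rw [v1] at a1 a2 a3 a4 b1
  rw [v2] at a4 b2
  obtain ⟨r1, r2⟩ := numerics h0 hη hH b1 b2 a1 a2 a3 a4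
  refine ⟨fun x y => ?_, fun x y => ?_⟩
  · have := r1 x y
    rw [hG]; linarith
  · have := r2 x y
    rw [hG]; linarith

/-- **Nontrivial Mrs. Gerber's Lemma with quantum side information (i.i.d. case).**
For density matrices `σ₀, σ₁` with conditional entropy
`H = H(X|B) = ln 2 + ½H(σ₀) + ½H(σ₁) − H((σ₀+σ₁)/2)` and
`G = H(X₁+X₂|B₁B₂)` the conditional entropy of the sum of two i.i.d. uniform binary
inputs given the two quantum outputs:
if `0 < H ≤ ½ ln 2` then `G ≥ H + 0.083·H/(1 − ln H)`, and
if `½ ln 2 ≤ H < ln 2` then `G ≥ H + 0.083·(ln 2 − H)/(1 − ln(ln 2 − H))`. -/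
theorem mrs_gerber_quantum_iid (d : ℕ) (σ₀ σ₁ : Matrix (Fin d) (Fin d) ℂ)
    (h0 : σ₀.PosSemidef) (h0t : σ₀.trace = 1)
    (h1 : σ₁.PosSemidef) (h1t : σ₁.trace = 1)
    (H G : ℝ)
    (hH : H = Real.log 2 + (1 / 2 : ℝ) * vN σ₀ + (1 / 2 : ℝ) * vN σ₁
        - vN ((1 / 2 : ℝ) • (σ₀ + σ₁)))
    (hG : G = Real.log 2
        + (1 / 2 : ℝ) * vN ((1 / 2 : ℝ) • (σ₀ ⊗ₖ σ₀ + σ₁ ⊗ₖ σ₁))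
        + (1 / 2 : ℝ) * vN ((1 / 2 : ℝ) • (σ₀ ⊗ₖ σ₁ + σ₁ ⊗ₖ σ₀))
        - vN (((1 / 2 : ℝ) • (σ₀ + σ₁)) ⊗ₖ ((1 / 2 : ℝ) • (σ₀ + σ₁)))) :
    (0 < H → H ≤ Real.log 2 / 2 →
        G ≥ H + 0.083 * (H / (1 - Real.log H)))
    ∧ (Real.log 2 / 2 ≤ H → H < Real.log 2 →
        G ≥ H + 0.083 * ((Real.log 2 - H) / (1 - Real.log (Real.log 2 - H)))) := by
  set A := (1 / 2 : ℝ) • (σ₀ + σ₁) with hA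
  set D := (1 / 2 : ℝ) • (σ₀ - σ₁) with hD
  have e0 : A + D = σ₀ := by
    rw [hA, hD, ← smul_add, add_add_sub_cancel, ← two_smul ℝ, smul_smul]; norm_num
  have e1 : A - D = σ₁ := by
    rw [hA, hD, ← smul_sub, add_sub_sub_cancel, ← two_smul ℝ, smul_smul]; norm_num
  have f0 : (1 / 2 : ℝ) • (σ₀ ⊗ₖ σ₀ + σ₁ ⊗ₖ σ₁) = A ⊗ₖ A + D ⊗ₖ D := by
    rw [← e0, ← e1]
    ext i j
    simp [kroneckerMap_apply]
    ring
  have f1 : (1 / 2 : ℝ) • (σ₀ ⊗ₖ σ₁ + σ₁ ⊗ₖ σ₀) = A ⊗ₖ A - D ⊗ₖ D := by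
    rw [← e0, ← e1]
    ext i j
    simp [kroneckerMap_apply]
    ring
  have half : (0 : ℝ) ≤ 1 / 2 := by norm_num
  have pA : A.PosSemidef := psd_smul (h0.add h1) half
  have pD : D.IsHermitian := herm_smul (h0.1.sub h1.1) _
  have k2 : (A ⊗ₖ A + D ⊗ₖ D).PosSemidef :=
    f0 ▸ psd_smul ((h0.kronecker h0).add (h1.kronecker h1)) half
  have k1 : (A ⊗ₖ A - D ⊗ₖ D).PosSemidef :=
    f1 ▸ psd_smul ((h0.kronecker h1).add (h1.kronecker h0)) half
  rw [f0, f1] at hG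
  clear_value A D
  subst e0 e1
  refine main_aux d A D pA pD h1 h0 h1t h0t k1 k2 H G ?_ ?_
  · rw [hH, vN_chi pA h1 h0]; ring
  · rw [hG, vN_chi (pA.kronecker pA) k1 k2]; ring
end
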